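/- For every integer m ≥ 1 there exists a constant c > 0 (depending only on m) such that the following holds: if an m-intersecting family of n closed Jordan curves in general position in the plane has exactly T touching pairs with T ≥ n, then the number of intersection points determined by the family is at least c · T · (T/n)^(1/(9m+45)). -/

import Mathlib

noncomputable section

abbrev Plane : Type := EuclideanSpace ℝ (Fin 2)

/-- A closed Jordan curve: a subset of the plane homeomorphic to the unit circle. -/
def IsJordanCurve (γ : Set Plane) : Prop :=
  Nonempty (γ ≃ₜ Metric.sphere (0 : Plane) 1)

/-- A Jordan arc: a subset of the plane homeomorphic to the closed unit interval. -/
def IsJordanArc (γ : Set Plane) : Prop :=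
  Nonempty (γ ≃ₜ unitInterval)

/-- General position: any two distinct members intersect in a finite set, and no point
of the plane lies on three distinct members. -/
def GenPos {n : ℕ} (γ : Fin n → Set Plane) : Prop :=
  (∀ i j : Fin n, i ≠ j → (γ i ∩ γ j).Finite) ∧
  (∀ p : Plane, ∀ i j k : Fin n, p ∈ γ i → p ∈ γ j → p ∈ γ k → i = j ∨ i = k ∨ j = k)

/-- `m`-intersecting: any two distinct members intersect in at most `m` points. -/
def MIntersecting {n : ℕ} (m : ℕ) (γ : Fin n → Set Plane) : Prop :=
  ∀ i j : Fin n, i ≠ j → (γ i ∩ γ j).ncard ≤ m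

/-- Two curves touch if their intersection is a singleton. -/
def Touches (a b : Set Plane) : Prop := ∃ x, a ∩ b = {x}

/-- The number of touching pairs of the family. -/
def touchingPairs {n : ℕ} (γ : Fin n → Set Plane) : ℕ :=
  {p : Fin n × Fin n | p.1 < p.2 ∧ Touches (γ p.1) (γ p.2)}.ncard

/-- The set of intersection points of the family: points lying on at least two
distinct members. -/
def interPoints {n : ℕ} (γ : Fin n → Set Plane) : Set Plane :=
  {x : Plane | ∃ i j : Fin n, i ≠ j ∧ x ∈ γ i ∧ x ∈ γ j}

/-! ## Part 1: five points cannot be joined pairwise in the plane without independent crossings -/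

/-- Continuous logarithms exist along nowhere vanishing maps on simply connected spaces. -/
theorem exists_log_lift {A : Type*} [TopologicalSpace A] [SimplyConnectedSpace A]
    [LocallyPathConnectedSpace A] (a₀ : A) (g : A → ℂ) (hg : Continuous g) (h0 : ∀ a, g a ≠ 0) :
    ∃ L : A → ℂ, Continuous L ∧ ∀ a, Complex.exp (L a) = g a := by
  obtain ⟨F, ⟨-, hF⟩, -⟩ := Complex.isCoveringMapOn_exp.existsUnique_continuousMap_lifts
    (⟨g, hg⟩ : C(A, ℂ)) (a₀ := a₀) (e₀ := Complex.log (g a₀)) (Complex.exp_log (h0 a₀))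
    (fun a => by simpa using h0 a)
  exact ⟨F, F.continuous, fun a => congrFun hF a⟩

theorem log_lift_diff_unique (L₁ L₂ : ℝ → ℂ) (h₁ : Continuous L₁) (h₂ : Continuous L₂)
    (c : ℂ) (hc : c ≠ 0)
    (h : ∀ t, Complex.exp (L₁ t) = c * Complex.exp (L₂ t)) : L₁ 1 - L₁ 0 = L₂ 1 - L₂ 0 := by
  obtain ⟨F, -, hF⟩ := Complex.isCoveringMapOn_exp.existsUnique_continuousMap_lifts
    (⟨fun t => Complex.exp (L₁ t), by fun_prop⟩ : C(ℝ, ℂ)) (a₀ := 0) (e₀ := L₁ 0) rfl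
    (fun a => by simp)
  have e1 := hF ⟨L₁, h₁⟩ ⟨rfl, rfl⟩
  have e2 := hF ⟨fun t => L₂ t + (L₁ 0 - L₂ 0), by fun_prop⟩ ⟨by simp, by
    funext t
    simp only [ContinuousMap.coe_mk, Function.comp_apply]
    rw [Complex.exp_add, Complex.exp_sub, h t, h 0]
    have := Complex.exp_ne_zero (L₂ 0)
    field_simp⟩
  have e3 := DFunLike.congr_fun (e1.trans e2.symm) (1 : ℝ)
  simp only [ContinuousMap.coe_mk] at e3
  rw [e3]; ring

theorem lift_square (f g : ℝ → ℂ) (hf : Continuous f) (hg : Continuous g)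
    (hfg : ∀ s t, f s ≠ g t) (A B C D : ℝ → ℂ)
    (hA : Continuous A) (hB : Continuous B) (hC : Continuous C) (hD : Continuous D)
    (eA : ∀ t, Complex.exp (A t) = f t - g 1) (eB : ∀ t, Complex.exp (B t) = f t - g 0)
    (eC : ∀ t, Complex.exp (C t) = g t - f 1) (eD : ∀ t, Complex.exp (D t) = g t - f 0) :
    (A 1 - A 0) - (B 1 - B 0) = (C 1 - C 0) - (D 1 - D 0) := by
  obtain ⟨L, hL, eL⟩ := exists_log_lift ((0, 0) : ℝ × ℝ) (fun p => f p.1 - g p.2)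
    (by fun_prop) (fun p => sub_ne_zero.2 (hfg _ _))
  rw [log_lift_diff_unique A (fun t => L (t, 1)) hA (by fun_prop) 1 one_ne_zero
      (by intro t; simp [eL, eA]),
    log_lift_diff_unique B (fun t => L (t, 0)) hB (by fun_prop) 1 one_ne_zero
      (by intro t; simp [eL, eB]),
    log_lift_diff_unique C (fun t => L (1, t)) hC (by fun_prop) (-1) (by norm_num)
      (by intro t; simp [eL, eC]),
    log_lift_diff_unique D (fun t => L (0, t)) hD (by fun_prop) (-1) (by norm_num)
      (by intro t; simp [eL, eD])]
  ring

theorem K5_complex (v : Fin 5 → ℂ) (f : Fin 5 → Fin 5 → ℝ → ℂ)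
    (hf : ∀ i j, i < j → Continuous (f i j)) (h0 : ∀ i j, i < j → f i j 0 = v i)
    (h1 : ∀ i j, i < j → f i j 1 = v j)
    (hd : ∀ i j k l, i < j → k < l → i ≠ k → i ≠ l → j ≠ k → j ≠ l → ∀ s t, f i j s ≠ f k l t) :
    False := by
  -- every vertex is off the edges not containing it
  have hv : ∀ i j k, i < j → k ≠ i → k ≠ j → ∀ s, f i j s ≠ v k := by
    intro i j k hij hki hkj s
    obtain ⟨l, hl⟩ : ∃ l : Fin 5, l ≠ i ∧ l ≠ j ∧ l ≠ k := by
      revert i j k; decide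
    rcases lt_or_gt_of_ne hl.2.2 with h | h
    · rw [← h1 l k h]; exact hd i j l k hij h hl.1.symm hki.symm hl.2.1.symm hkj.symm s 1
    · rw [← h0 k l h]; exact hd i j k l hij h hki.symm hl.1.symm hkj.symm hl.2.1.symm s 0
  have hvv : ∀ i j, i ≠ j → v i ≠ v j := by
    intro i j hij
    obtain ⟨l, hl⟩ : ∃ l : Fin 5, l ≠ i ∧ l ≠ j := by
      revert i j; decide
    rcases lt_or_gt_of_ne hl.1 with h | h
    · rw [← h1 l i h]; exact hv l i j h hl.2.symm hij.symm 1
    · rw [← h0 i l h]; exact hv i l j h hij.symm hl.2.symm 0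
  have hL : ∀ i j k, ∃ L : ℝ → ℂ, (i < j → k ≠ i → k ≠ j → Continuous L ∧
      ∀ t, Complex.exp (L t) = f i j t - v k) := by
    intro i j k
    by_cases h : i < j ∧ k ≠ i ∧ k ≠ j
    · have := hf i j h.1
      obtain ⟨L, hL⟩ := exists_log_lift (0 : ℝ) (fun t => f i j t - v k) (by fun_prop)
        (fun t => sub_ne_zero.2 (hv i j k h.1 h.2.1 h.2.2 t))
      exact ⟨L, fun _ _ _ => hL⟩
    · exact ⟨0, fun a b c => (h ⟨a, b, c⟩).elim⟩
  choose L hL using hL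
  let b : Fin 5 → Fin 5 → ℂ := fun i j => Complex.log (v (max i j) - v (min i j))
  have hb : ∀ i j, b i j = b j i := fun i j => by simp only [b, max_comm, min_comm]
  let e : Fin 5 → Fin 5 → ℤ := fun k j => if j < k then 1 else 0
  have hbe : ∀ k j, k ≠ j → Complex.exp (b k j + e k j * (Real.pi * Complex.I)) = v j - v k := by
    intro k j hkj
    rcases lt_or_gt_of_ne hkj with h | h
    · simp only [b, e, not_lt.2 h.le, max_eq_right h.le, min_eq_left h.le, if_false]
      simp [Complex.exp_log (sub_ne_zero.2 (hvv j k hkj.symm))]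
    · simp only [b, e, h, max_eq_left h.le, min_eq_right h.le, if_true]
      rw [Complex.exp_add, Complex.exp_log (sub_ne_zero.2 (hvv k j hkj))]
      simp
  have hn : ∀ i j k, ∃ n : ℤ, i < j → k ≠ i → k ≠ j → L i j k 1 - L i j k 0 =
      (b k j + e k j * (Real.pi * Complex.I)) - (b k i + e k i * (Real.pi * Complex.I))
        + n * (2 * Real.pi * Complex.I) := by
    intro i j k
    by_cases h : i < j ∧ k ≠ i ∧ k ≠ j
    · obtain ⟨hij, hki, hkj⟩ := h
      have hl := (hL i j k hij hki hkj).2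
      have : Complex.exp (L i j k 1 - L i j k 0) = Complex.exp
          ((b k j + e k j * (Real.pi * Complex.I)) - (b k i + e k i * (Real.pi * Complex.I))) := by
        rw [Complex.exp_sub, Complex.exp_sub, hbe k j hkj, hbe k i hki, hl, hl, h0 i j hij,
          h1 i j hij]
      obtain ⟨n, hn⟩ := Complex.exp_eq_exp_iff_exists_int.1 this
      exact ⟨n, fun _ _ _ => hn⟩
    · exact ⟨0, fun a b c => (h ⟨a, b, c⟩).elim⟩
  choose n hn using hn
  have key : ∀ i j k l, i < j → k < l → i ≠ k → i ≠ l → j ≠ k → j ≠ l →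
      (e l j - e l i) - (e k j - e k i) - (e j l - e j k) + (e i l - e i k)
        + 2 * (n i j l - n i j k - n k l j + n k l i) = 0 := by
    intro i j k l hij hkl hik hil hjk hjl
    have c1 := hL i j l hij hil.symm hjl.symm
    have c2 := hL i j k hij hik.symm hjk.symm
    have c3 := hL k l j hkl hjk hjl
    have c4 := hL k l i hkl hik hil
    have := lift_square (f i j) (f k l) (hf _ _ hij) (hf _ _ hkl)
      (hd i j k l hij hkl hik hil hjk hjl) _ _ _ _ c1.1 c2.1 c3.1 c4.1
      (by rw [h1 k l hkl]; exact c1.2) (by rw [h0 k l hkl]; exact c2.2)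
      (by rw [h1 i j hij]; exact c3.2) (by rw [h0 i j hij]; exact c4.2)
    rw [hn i j l hij hil.symm hjl.symm, hn i j k hij hik.symm hjk.symm,
      hn k l j hkl hjk hjl, hn k l i hkl hik hil, hb l j, hb l i, hb k j, hb k i] at this
    have hpi : (Real.pi : ℂ) * Complex.I ≠ 0 := by
      simp [Real.pi_ne_zero]
    have h2 : (((e l j - e l i) - (e k j - e k i) - (e j l - e j k) + (e i l - e i k)
        + 2 * (n i j l - n i j k - n k l j + n k l i) : ℤ) : ℂ) * (Real.pi * Complex.I) = 0 := by
      push_cast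
      linear_combination this
    have h3 := (mul_eq_zero.1 h2).resolve_right hpi
    exact_mod_cast h3
  have E : ∀ k j : Fin 5, e k j = if j < k then 1 else 0 := fun _ _ => rfl
  simp only [E] at key
  clear_value e b
  have a1 := key 0 1 2 3 (by decide) (by decide) (by decide) (by decide) (by decide) (by decide)
  have a2 := key 0 1 2 4 (by decide) (by decide) (by decide) (by decide) (by decide) (by decide)
  have a3 := key 0 1 3 4 (by decide) (by decide) (by decide) (by decide) (by decide) (by decide)
  have a4 := key 0 2 1 3 (by decide) (by decide) (by decide) (by decide) (by decide) (by decide)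
  have a5 := key 0 2 1 4 (by decide) (by decide) (by decide) (by decide) (by decide) (by decide)
  have a6 := key 0 2 3 4 (by decide) (by decide) (by decide) (by decide) (by decide) (by decide)
  have a7 := key 0 3 1 2 (by decide) (by decide) (by decide) (by decide) (by decide) (by decide)
  have a8 := key 0 3 1 4 (by decide) (by decide) (by decide) (by decide) (by decide) (by decide)
  have a9 := key 0 3 2 4 (by decide) (by decide) (by decide) (by decide) (by decide) (by decide)
  have b1 := key 0 4 1 2 (by decide) (by decide) (by decide) (by decide) (by decide) (by decide)
  have b2 := key 0 4 1 3 (by decide) (by decide) (by decide) (by decide) (by decide) (by decide)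
  have b3 := key 0 4 2 3 (by decide) (by decide) (by decide) (by decide) (by decide) (by decide)
  have b4 := key 1 2 3 4 (by decide) (by decide) (by decide) (by decide) (by decide) (by decide)
  have b5 := key 1 3 2 4 (by decide) (by decide) (by decide) (by decide) (by decide) (by decide)
  have b6 := key 1 4 2 3 (by decide) (by decide) (by decide) (by decide) (by decide) (by decide)
  simp at a1 a2 a3 a4 a5 a6 a7 a8 a9 b1 b2 b3 b4 b5 b6
  omega


/-- The coordinate map from the plane to the complex numbers. -/
def toC (p : Plane) : ℂ := ⟨p 0, p 1⟩

theorem toC_continuous : Continuous toC := by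
  have : toC = fun p : Plane => ((p 0 : ℝ) : ℂ) + ((p 1 : ℝ) : ℂ) * Complex.I := by
    funext p; apply Complex.ext <;> simp [toC]
  rw [this]; fun_prop

theorem toC_injective : Function.Injective toC := by
  intro p q h
  have h0 : p 0 = q 0 := congrArg Complex.re h
  have h1 : p 1 = q 1 := congrArg Complex.im h
  ext i
  fin_cases i
  · exact h0
  · exact h1

/-- No five points can be joined pairwise so that the connections of disjoint pairs are disjoint. -/
theorem K5_plane (v : Fin 5 → Plane) (E : Fin 5 → Fin 5 → Set Plane)
    (hE : ∀ i j, i < j → JoinedIn (E i j) (v i) (v j))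
    (hd : ∀ i j k l, i < j → k < l → i ≠ k → i ≠ l → j ≠ k → j ≠ l →
      Disjoint (E i j) (E k l)) : False := by
  have : ∀ i j, ∃ f : ℝ → Plane, i < j → Continuous f ∧ f 0 = v i ∧ f 1 = v j ∧ ∀ t, f t ∈ E i j := by
    intro i j
    by_cases hij : i < j
    · obtain ⟨γ, hγ⟩ := hE i j hij
      refine ⟨γ.extend, fun _ => ⟨γ.continuous_extend, by simp, by simp, fun t => ?_⟩⟩
      have : γ.extend t ∈ Set.range γ.extend := ⟨t, rfl⟩
      rw [Path.extend_range] at this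
      obtain ⟨u, hu⟩ := this
      rw [← hu]; exact hγ u
    · exact ⟨fun _ => 0, fun h => (hij h).elim⟩
  choose f hf using this
  refine K5_complex (fun i => toC (v i)) (fun i j t => toC (f i j t)) ?_ ?_ ?_ ?_
  · intro i j h; exact toC_continuous.comp (hf i j h).1
  · intro i j h; simp [(hf i j h).2.1]
  · intro i j h; simp [(hf i j h).2.2.1]
  · intro i j k l hij hkl a b c d s t h
    exact Set.disjoint_left.1 (hd i j k l hij hkl a b c d) ((hf i j hij).2.2.2 s)
      (by rw [toC_injective h]; exact (hf k l hkl).2.2.2 t)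

/-! ## Part 2: a separator theorem for graphs without a `K₅` minor -/

namespace Sep
open Classical Finset

variable {V : Type*} (adj : V → V → Prop)

/-- A nonempty vertex set which is connected in the graph `adj`. -/
def Conn (S : Finset V) : Prop :=
  S.Nonempty ∧ ∀ P ⊆ S, P.Nonempty → (∀ v ∈ P, ∀ w ∈ S, adj v w → w ∈ P) → P = S

/-- `D` is closed under adjacency inside `U`. -/
def ClosedIn (U D : Finset V) : Prop := ∀ v ∈ D, ∀ w ∈ U, adj v w → w ∈ D

variable {adj}

theorem Conn.sub_of_closed {S P : Finset V} (hS : Conn adj S)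
    (h : ∀ v ∈ P, v ∈ S → ∀ w ∈ S, adj v w → w ∈ P) (x : V) (hx : x ∈ S) (hxP : x ∈ P) : S ⊆ P := by
  have := hS.2 (S ∩ P) inter_subset_left ⟨x, by simp [hx, hxP]⟩ (by
    intro v hv w hw hvw
    simp only [mem_inter] at hv ⊢
    exact ⟨hw, h v hv.2 hv.1 w hw hvw⟩)
  rw [← this]
  exact inter_subset_right

theorem conn_singleton (v : V) : Conn adj {v} := by
  refine ⟨singleton_nonempty v, fun P hP hne _ => ?_⟩
  rcases subset_singleton_iff.1 hP with h | h
  · simp [h] at hne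
  · exact h

theorem conn_union (hs : ∀ v w, adj v w → adj w v) {S T : Finset V} (hS : Conn adj S)
    (hT : Conn adj T) (v w : V) (hv : v ∈ S) (hw : w ∈ T) (h : adj v w ∨ v = w) :
    Conn adj (S ∪ T) := by
  refine ⟨hS.1.mono subset_union_left, fun P hP hne hcl => ?_⟩
  refine Subset.antisymm hP ?_
  have h1 : ∀ x ∈ P, x ∈ S → S ⊆ P := fun x hx hxS =>
    hS.sub_of_closed (fun a ha _ b hb hab => hcl a ha b (mem_union_left _ hb) hab) x hxS hx
  have h2 : ∀ x ∈ P, x ∈ T → T ⊆ P := fun x hx hxS =>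
    hT.sub_of_closed (fun a ha _ b hb hab => hcl a ha b (mem_union_right _ hb) hab) x hxS hx
  obtain ⟨x, hx⟩ := hne
  rcases mem_union.1 (hP hx) with hxS | hxT
  · have a1 := h1 x hx hxS
    have : w ∈ P := by
      rcases h with h | h
      · exact hcl v (a1 hv) w (mem_union_right _ hw) h
      · exact h ▸ a1 hv
    exact union_subset a1 (h2 w this hw)
  · have a1 := h2 x hx hxT
    have : v ∈ P := by
      rcases h with h | h
      · exact hcl w (a1 hw) v (mem_union_left _ hv) (hs _ _ h)
      · exact h ▸ a1 hw
    exact union_subset (h1 v this hv) a1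

theorem conn_insert (hs : ∀ v w, adj v w → adj w v) {S : Finset V} (hS : Conn adj S)
    (v w : V) (hv : v ∈ S) (h : adj v w) : Conn adj (insert w S) := by
  have := conn_union hs hS (conn_singleton w) v w hv (mem_singleton_self w) (Or.inl h)
  rwa [union_comm, ← insert_eq] at this

/-- The connected component of `v` inside `U`. -/
def comp (adj : V → V → Prop) (U : Finset V) (v : V) : Finset V :=
  U.filter (fun w => ∃ S ⊆ U, Conn adj S ∧ v ∈ S ∧ w ∈ S)

theorem comp_sub (U : Finset V) (v : V) : comp adj U v ⊆ U := filter_subset _ _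

theorem mem_comp_self {U : Finset V} {v : V} (hv : v ∈ U) : v ∈ comp adj U v := by
  simp only [comp, mem_filter]
  exact ⟨hv, {v}, by simpa using hv, conn_singleton v, by simp, by simp⟩

theorem sub_comp (hs : ∀ v w, adj v w → adj w v) {U F : Finset V} {v x : V} (hF : Conn adj F)
    (hFU : F ⊆ U) (hx : x ∈ F) (hxc : x ∈ comp adj U v) : F ⊆ comp adj U v := by
  simp only [comp, mem_filter] at hxc
  obtain ⟨-, S, hSU, hS, hvS, hxS⟩ := hxc
  intro y hy
  simp only [comp, mem_filter]
  exact ⟨hFU hy, S ∪ F, union_subset hSU hFU, conn_union hs hS hF x x hxS hx (Or.inr rfl),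
    mem_union_left _ hvS, mem_union_right _ hy⟩

theorem conn_comp {U : Finset V} {v : V} (hv : v ∈ U) : Conn adj (comp adj U v) := by
  refine ⟨⟨v, mem_comp_self hv⟩, fun P hP hne hcl => Subset.antisymm hP ?_⟩
  have key : ∀ S ⊆ U, Conn adj S → v ∈ S → ∀ x ∈ S, x ∈ P → S ⊆ P := by
    intro S hSU hS hvS x hx hxP
    refine hS.sub_of_closed (fun a ha _ b hb hab => hcl a ha b ?_ hab) x hx hxP
    simp only [comp, mem_filter]
    exact ⟨hSU hb, S, hSU, hS, hvS, hb⟩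
  obtain ⟨x, hx⟩ := hne
  have hx' := hP hx
  simp only [comp, mem_filter] at hx'
  obtain ⟨-, S, hSU, hS, hvS, hxS⟩ := hx'
  have hvP : v ∈ P := key S hSU hS hvS x hxS hx hvS
  intro y hy
  simp only [comp, mem_filter] at hy
  obtain ⟨-, S', hSU', hS', hvS', hyS'⟩ := hy
  exact key S' hSU' hS' hvS' v hvS' hvP hyS'

theorem closed_comp (hs : ∀ v w, adj v w → adj w v) {U : Finset V} {v : V} :
    ClosedIn adj U (comp adj U v) := by
  intro a ha w hw haw
  simp only [comp, mem_filter] at ha ⊢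
  obtain ⟨-, S, hSU, hS, hvS, haS⟩ := ha
  exact ⟨hw, insert w S, insert_subset hw hSU, conn_insert hs hS a w haS haw,
    mem_insert_of_mem hvS, mem_insert_self _ _⟩

/-- Either a small connected set meets all `A l`, or a small set separates them. -/
theorem tree_or_sep (hs : ∀ v w, adj v w → adj w v) (U : Finset V) (I : Finset (Fin 5))
    (A : Fin 5 → Finset V) (r : ℕ) (hr : 1 ≤ r) :
    (∃ S ⊆ U, Conn adj S ∧ S.card ≤ r ∧ ∀ l ∈ I, (S ∩ A l).Nonempty) ∨
    (∃ Z ⊆ U, r * Z.card ≤ 6 * U.card ∧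
      ∀ F ⊆ U, Conn adj F → Disjoint F Z → ∃ l ∈ I, ¬ (F ∩ A l).Nonempty) := by
  by_contra hcon
  push Not at hcon
  obtain ⟨hno, hsep⟩ := hcon
  set D : ℕ → ℕ → Finset V := fun j i => U.filter (fun v => ∃ S ⊆ U, Conn adj S ∧ v ∈ S ∧
    S.card ≤ j ∧ ∀ l ∈ I, (l : ℕ) < i → (S ∩ A l).Nonempty) with hD
  have hDU : ∀ j i, D j i ⊆ U := fun j i => filter_subset _ _
  have hmono : ∀ i j, D j i ⊆ D (j+1) i := by
    intro i j v hv
    simp only [hD, mem_filter] at hv ⊢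
    obtain ⟨h1, S, h2, h3, h4, h5, h6⟩ := hv
    exact ⟨h1, S, h2, h3, h4, by omega, h6⟩
  set Zf : ℕ → Finset V := fun j => (range 6).biUnion (fun i => D (j+1) i \ D j i) with hZf
  have hsum : ∑ j ∈ range r, (Zf (j+1)).card ≤ 6 * U.card := by
    calc ∑ j ∈ range r, (Zf (j+1)).card
        ≤ ∑ j ∈ range r, ∑ i ∈ range 6, (D (j+1+1) i \ D (j+1) i).card :=
          sum_le_sum fun j _ => card_biUnion_le
      _ = ∑ i ∈ range 6, ∑ j ∈ range r, (D (j+1+1) i \ D (j+1) i).card := sum_comm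
      _ ≤ ∑ i ∈ range 6, U.card := by
          refine sum_le_sum fun i _ => ?_
          have : ∀ r, ∑ j ∈ range r, (D (j+1+1) i \ D (j+1) i).card ≤ (D (r+1) i).card := by
            intro r
            induction r with
            | zero => simp
            | succ r ih =>
              rw [sum_range_succ]
              have := card_sdiff_add_card_eq_card (hmono i (r+1))
              omega
          exact (this r).trans (card_le_card (hDU _ _))
      _ = 6 * U.card := by simp
  obtain ⟨j, hj, hjr⟩ : ∃ j ∈ range r, r * (Zf (j+1)).card ≤ 6 * U.card := by
    by_contra hc
    push Not at hc
    have h1 : ∑ j ∈ range r, r * (Zf (j+1)).card > ∑ j ∈ range r, 6 * U.card :=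
      sum_lt_sum_of_nonempty ⟨0, by simp; omega⟩ hc
    rw [← mul_sum] at h1
    simp only [sum_const, card_range, smul_eq_mul] at h1
    have := Nat.mul_le_mul_left r hsum
    omega
  have hjr' : j + 1 ≤ r := by simpa using hj
  obtain ⟨F, hFU, hF, hFZ, hFA⟩ := hsep (Zf (j+1))
    (biUnion_subset.2 fun i _ => sdiff_subset.trans (hDU _ _)) hjr
  have hprop : ∀ i ≤ 5, F ⊆ D (j+1) i := by
    intro i
    induction i with
    | zero =>
      intro _ v hv
      simp only [hD, mem_filter]
      exact ⟨hFU hv, {v}, by simpa using hFU hv, conn_singleton v, by simp, by simp, by simp⟩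
    | succ i ih =>
      intro hi
      have ih := ih (by omega)
      by_cases hiI : (⟨i, by omega⟩ : Fin 5) ∈ I
      · obtain ⟨x, hx⟩ := hFA _ hiI
        simp only [mem_inter] at hx
        have hxD : x ∈ D (j+1) (i+1) := by
          have := ih hx.1
          simp only [hD, mem_filter] at this ⊢
          obtain ⟨h1, S, h2, h3, h4, h5, h6⟩ := this
          refine ⟨h1, S, h2, h3, h4, h5, fun l hl hli => ?_⟩
          by_cases hl' : (l : ℕ) < i
          · exact h6 l hl hl'
          · have : l = ⟨i, by omega⟩ := Fin.ext (by simp only; omega)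
            exact ⟨x, by rw [this]; simp [h4, hx.2]⟩
        refine hF.sub_of_closed (fun v hv hvF w hw hvw => ?_) x hx.1 hxD
        by_contra hwD
        have hw2 : w ∈ D (j+1+1) (i+1) := by
          simp only [hD, mem_filter] at hv ⊢
          obtain ⟨h1, S, h2, h3, h4, h5, h6⟩ := hv
          refine ⟨hFU hw, insert w S, insert_subset (hFU hw) h2, conn_insert hs h3 v w h4 hvw,
            mem_insert_self _ _, (card_insert_le _ _).trans (by omega), fun l hl hli => ?_⟩
          exact (h6 l hl hli).mono (inter_subset_inter_right (subset_insert _ _))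
        have : w ∈ Zf (j+1) := by
          simp only [hZf, mem_biUnion, mem_sdiff]
          exact ⟨i+1, by simp; omega, hw2, hwD⟩
        exact disjoint_left.1 hFZ hw this
      · intro v hv
        have := ih hv
        simp only [hD, mem_filter] at this ⊢
        obtain ⟨h1, S, h2, h3, h4, h5, h6⟩ := this
        refine ⟨h1, S, h2, h3, h4, h5, fun l hl hli => h6 l hl ?_⟩
        rcases Nat.lt_succ_iff_lt_or_eq.1 hli with h | h
        · exact h
        · exact absurd hl (by convert hiI)
  obtain ⟨x, hx⟩ := hF.1
  have := hprop 5 le_rfl hx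
  simp only [hD, mem_filter] at this
  obtain ⟨h1, S, h2, h3, h4, h5, h6⟩ := this
  obtain ⟨l, hl, hlS⟩ := hno S h2 h3 (by omega)
  exact (not_nonempty_iff_eq_empty.2 hlS) (h6 l hl l.2)

end Sep

namespace Sep
open Classical Finset

variable {V : Type*} {adj : V → V → Prop}

/-- A `K₅` minor inside `W`. -/
def K5Minor (adj : V → V → Prop) (W : Finset V) : Prop :=
  ∃ B : Fin 5 → Finset V, (∀ l, Conn adj (B l) ∧ B l ⊆ W) ∧
    ∀ k l, k ≠ l → Disjoint (B k) (B l) ∧ ∃ v ∈ B k, ∃ w ∈ B l, adj v w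

/-- A big component of `W \ X`. -/
def Big (adj : V → V → Prop) (W X D : Finset V) : Prop :=
  D ⊆ W \ X ∧ Conn adj D ∧ ClosedIn adj (W \ X) D ∧ W.card < 2 * D.card

theorem big_meet {W D E : Finset V} (hD : D ⊆ W) (hE : E ⊆ W) (h1 : W.card < 2 * D.card)
    (h2 : W.card < 2 * E.card) : ∃ x ∈ D, x ∈ E := by
  by_contra hc
  push Not at hc
  have := card_union_of_disjoint (disjoint_left.2 hc)
  have := card_le_card (union_subset hD hE)
  omega

theorem step (hs : ∀ v w, adj v w → adj w v) (W : Finset V) (r : ℕ) (hr : 1 ≤ r)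
    (hrW : 6 * W.card ≤ r * r)
    (H : ∀ X ⊆ W, X.card ≤ 6 * r → ∃ D, Big adj W X D) (N : ℕ) :
    ∀ (I : Finset (Fin 5)) (B : Fin 5 → Finset V) (X D : Finset V),
      (∀ l ∈ I, Conn adj (B l) ∧ B l ⊆ W) →
      (∀ k ∈ I, ∀ l ∈ I, k ≠ l → Disjoint (B k) (B l) ∧ ∃ v ∈ B k, ∃ w ∈ B l, adj v w) →
      X ⊆ I.biUnion B → (∀ l ∈ I, (X ∩ B l).card ≤ r) → Big adj W X D →
      (∀ l ∈ I, Disjoint D (B l)) → 6 * D.card + I.card ≤ N → K5Minor adj W := by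
  induction N with
  | zero =>
    intro I B X D _ _ _ _ hD _ hN
    have := hD.2.2.2
    omega
  | succ N ih =>
    intro I B X D hB hBB hX hXr hD hDB hN
    by_cases hI : I = univ
    · subst hI
      exact ⟨B, fun l => hB l (mem_univ _), fun k l hkl => hBB k (mem_univ _) l (mem_univ _) hkl⟩
    obtain ⟨k, hk⟩ : ∃ k, k ∉ I := by
      by_contra hc
      push Not at hc
      exact hI (eq_univ_iff_forall.2 hc)
    have hIc : I.card ≤ 5 := by simpa using card_le_univ I
    obtain ⟨hDX, hDc, hDcl, hDb⟩ := hD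
    have hDW : D ⊆ W := hDX.trans sdiff_subset
    have hXW : X ⊆ W := hX.trans (biUnion_subset.2 fun l hl => (hB l hl).2)
    have hXc : X.card ≤ 5 * r := by
      have : X = I.biUnion (fun l => X ∩ B l) := by
        ext x
        simp only [mem_biUnion, mem_inter]
        constructor
        · intro hx
          obtain ⟨l, hl, hxl⟩ := mem_biUnion.1 (hX hx)
          exact ⟨l, hl, hx, hxl⟩
        · rintro ⟨l, hl, hx, -⟩
          exact hx
      rw [this]
      refine card_biUnion_le.trans ((sum_le_sum hXr).trans ?_)
      simp only [sum_const, smul_eq_mul]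
      exact Nat.mul_le_mul_right _ hIc
    have hmono : ∀ Y E, X ⊆ Y → Big adj W Y E → E ⊆ D := by
      intro Y E hXY hE
      obtain ⟨x, hx1, hx2⟩ := big_meet hDW (hE.1.trans sdiff_subset) hDb hE.2.2.2
      refine hE.2.1.sub_of_closed (fun v hv hvE w hw hvw => hDcl v hv w ?_ hvw) x hx2 hx1
      have := hE.1 hw
      simp only [mem_sdiff] at this ⊢
      exact ⟨this.1, fun h => this.2 (hXY h)⟩
    set A : Fin 5 → Finset V := fun l => D.filter (fun v => ∃ w ∈ B l, adj v w) with hA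
    by_cases ha : ∃ l ∈ I, ¬ (A l).Nonempty
    · obtain ⟨l, hl, hAl⟩ := ha
      refine ih (I.erase l) B (X \ B l) D (fun j hj => hB j (mem_of_mem_erase hj))
        (fun i hi j hj => hBB i (mem_of_mem_erase hi) j (mem_of_mem_erase hj)) ?_ ?_ ?_
        (fun j hj => hDB j (mem_of_mem_erase hj)) ?_
      · intro x hx
        simp only [mem_sdiff] at hx
        obtain ⟨j, hj, hxj⟩ := mem_biUnion.1 (hX hx.1)
        exact mem_biUnion.2 ⟨j, mem_erase.2 ⟨fun h => hx.2 (h ▸ hxj), hj⟩, hxj⟩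
      · intro j hj
        exact (card_le_card (inter_subset_inter_right sdiff_subset)).trans
          (hXr j (mem_of_mem_erase hj))
      · refine ⟨hDX.trans (sdiff_subset_sdiff le_rfl sdiff_subset), hDc, ?_, hDb⟩
        intro v hv w hw hvw
        simp only [mem_sdiff] at hw
        by_cases hwX : w ∈ X
        · exact absurd ⟨v, by simp only [hA, mem_filter]; exact ⟨hv, w, by tauto, hvw⟩⟩ hAl
        · exact hDcl v hv w (by simp [hw.1, hwX]) hvw
      · have := card_erase_add_one hl
        omega
    push Not at ha
    rcases tree_or_sep hs D I A r hr with ⟨S, hSD, hSc, hSr, hSA⟩ | ⟨Z, hZD, hZr, hZ⟩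
    · have hSB : ∀ l ∈ I, Disjoint S (B l) := fun l hl => disjoint_of_subset_left hSD (hDB l hl)
      have hXS : (X ∪ S).card ≤ 6 * r := (card_union_le _ _).trans (by omega)
      obtain ⟨E, hE⟩ := H (X ∪ S) (union_subset hXW (hSD.trans hDW)) hXS
      have hED := hmono _ E subset_union_left hE
      have hES : Disjoint E S := by
        refine disjoint_left.2 fun x hx hxS => ?_
        have := hE.1 hx
        simp only [mem_sdiff, mem_union] at this
        tauto
      have hne : ∀ l ∈ I, l ≠ k := fun l hl h => hk (h ▸ hl)
      have hadjS : ∀ l ∈ I, ∃ v ∈ S, ∃ w ∈ B l, adj v w := by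
        intro l hl
        obtain ⟨x, hx⟩ := hSA l hl
        simp only [hA, mem_inter, mem_filter] at hx
        exact ⟨x, hx.1, hx.2.2⟩
      refine ih (insert k I) (Function.update B k S) (X ∪ S) E ?_ ?_ ?_ ?_ hE ?_ ?_
      · intro l hl
        rcases mem_insert.1 hl with rfl | hl
        · simpa using ⟨hSc, hSD.trans hDW⟩
        · simpa [Function.update_of_ne (hne l hl)] using hB l hl
      · intro i hi j hj hij
        rcases mem_insert.1 hi with h | hiI
        · subst h
          have hj : j ∈ I := (mem_insert.1 hj).resolve_left (Ne.symm hij)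
          simp only [Function.update_self, Function.update_of_ne (hne j hj)]
          exact ⟨hSB j hj, hadjS j hj⟩
        · rcases mem_insert.1 hj with h | hj
          · subst h
            simp only [Function.update_self, Function.update_of_ne (hne i hiI)]
            obtain ⟨v, hv, w, hw, hvw⟩ := hadjS i hiI
            exact ⟨(hSB i hiI).symm, w, hw, v, hv, hs _ _ hvw⟩
          · simp only [Function.update_of_ne (hne i hiI), Function.update_of_ne (hne j hj)]
            exact hBB i hiI j hj hij
      · intro x hx
        rcases mem_union.1 hx with hx | hx
        · obtain ⟨l, hl, hxl⟩ := mem_biUnion.1 (hX hx)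
          exact mem_biUnion.2 ⟨l, mem_insert_of_mem hl, by
            simpa [Function.update_of_ne (hne l hl)] using hxl⟩
        · exact mem_biUnion.2 ⟨k, mem_insert_self _ _, by simpa using hx⟩
      · intro l hl
        rcases mem_insert.1 hl with h | hl
        · subst h
          simp only [Function.update_self]
          exact (card_le_card inter_subset_right).trans hSr
        · simp only [Function.update_of_ne (hne l hl)]
          refine (card_le_card ?_).trans (hXr l hl)
          intro x hx
          simp only [mem_inter, mem_union] at hx ⊢
          refine ⟨hx.1.resolve_right fun h => disjoint_left.1 (hSB l hl) h hx.2, hx.2⟩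
      · intro l hl
        rcases mem_insert.1 hl with h | hl
        · subst h
          simpa using hES
        · simp only [Function.update_of_ne (hne l hl)]
          exact disjoint_of_subset_left hED (hDB l hl)
      · have h1 : E.card + S.card ≤ D.card := by
          rw [← card_union_of_disjoint hES]
          exact card_le_card (union_subset hED hSD)
        have h2 := hSc.1.card_pos
        have h3 := card_insert_le k I
        omega
    · have hZc : Z.card ≤ r := by
        have h1 : r * Z.card ≤ r * r := hZr.trans
          ((Nat.mul_le_mul_left 6 (card_le_card hDW)).trans hrW)
        exact Nat.le_of_mul_le_mul_left h1 (by omega)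
      have hXZ : (X ∪ Z).card ≤ 6 * r := (card_union_le _ _).trans (by omega)
      obtain ⟨E, hE⟩ := H (X ∪ Z) (union_subset hXW (hZD.trans hDW)) hXZ
      have hED := hmono _ E subset_union_left hE
      have hEZ : Disjoint E Z := by
        refine disjoint_left.2 fun x hx hxS => ?_
        have := hE.1 hx
        simp only [mem_sdiff, mem_union] at this
        tauto
      obtain ⟨i, hi, hEi⟩ := hZ E hED hE.2.1 hEZ
      have hEi' : ∀ v ∈ E, ∀ w ∈ B i, ¬ adj v w := by
        intro v hv w hw hvw
        exact hEi ⟨v, by simp only [hA, mem_inter, mem_filter]; exact ⟨hv, hED hv, w, hw, hvw⟩⟩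
      obtain ⟨b, hb⟩ := (hB i hi).1.1
      set U := B i ∪ (D \ E) with hU
      set C := comp adj U b with hC
      have hbU : b ∈ U := mem_union_left _ hb
      have hBC : B i ⊆ C := sub_comp hs (hB i hi).1 subset_union_left hb (mem_comp_self hbU)
      have hCc : Conn adj C := conn_comp hbU
      have hCU : C ⊆ U := comp_sub _ _
      have hCcl : ClosedIn adj U C := closed_comp hs
      have hEC : Disjoint E C := by
        refine disjoint_left.2 fun x hx hxC => ?_
        have := hCU hxC
        simp only [hU, mem_union, mem_sdiff] at this
        rcases this with h | h
        · exact disjoint_left.1 (hDB i hi) (hED hx) h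
        · exact h.2 hx
      have hCD : ∀ x ∈ C, x ∈ B i ∨ x ∈ D := by
        intro x hx
        have := hCU hx
        simp only [hU, mem_union, mem_sdiff] at this
        tauto
      have hDxX : ∀ x ∈ D, x ∉ X := fun x hx => (mem_sdiff.1 (hDX hx)).2
      have hCB : ∀ l ∈ I, l ≠ i → Disjoint C (B l) := by
        intro l hl hli
        refine disjoint_left.2 fun x hx hxl => ?_
        rcases hCD x hx with h | h
        · exact disjoint_left.1 (hBB l hl i hi hli).1 hxl h
        · exact disjoint_left.1 (hDB l hl) h hxl
      have hX'c : ((X \ B i) ∪ (Z ∩ C)).card ≤ 6 * r :=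
        (card_le_card (union_subset_union sdiff_subset inter_subset_left)).trans hXZ
      obtain ⟨E', hE'⟩ := H ((X \ B i) ∪ (Z ∩ C)) (union_subset (sdiff_subset.trans hXW)
        (inter_subset_left.trans (hZD.trans hDW))) hX'c
      have hE'sub : E' ⊆ D \ C := by
        obtain ⟨x, hx1, hx2⟩ := big_meet (hE.1.trans sdiff_subset) (hE'.1.trans sdiff_subset)
          hE.2.2.2 hE'.2.2.2
        refine hE'.2.1.sub_of_closed ?_ x hx2
          (mem_sdiff.2 ⟨hED hx1, fun h => disjoint_left.1 hEC hx1 h⟩)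
        intro v hv hvE' w hw hvw
        have hw' := hE'.1 hw
        simp only [mem_sdiff, mem_union, mem_inter] at hv hw'
        obtain ⟨hwW, hwX⟩ := hw'
        have hvE : v ∉ E → v ∈ U := fun h => mem_union_right _ (mem_sdiff.2 ⟨hv.1, h⟩)
        have hwC : w ∉ C := by
          intro hwC
          by_cases hvE0 : v ∈ E
          · by_cases hwB : w ∈ B i
            · exact hEi' v hvE0 w hwB hvw
            · have h1 : w ∈ E := hE.2.2.1 v hvE0 w (by
                simp only [mem_sdiff, mem_union]
                tauto) hvw
              exact disjoint_left.1 hEC h1 hwC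
          · exact hv.2 (hCcl w hwC v (hvE hvE0) (hs _ _ hvw))
        have hwB : w ∉ B i := fun h => hwC (hBC h)
        exact mem_sdiff.2 ⟨hDcl v hv.1 w (by simp only [mem_sdiff]; tauto) hvw, hwC⟩
      have hup : ∀ l, l ≠ i → Function.update B i C l = B l := fun l hl =>
        Function.update_of_ne hl _ _
      have hupi : Function.update B i C i = C := Function.update_self _ _ _
      refine ih I (Function.update B i C) ((X \ B i) ∪ (Z ∩ C)) E' ?_ ?_ ?_ ?_ hE' ?_ ?_
      · intro l hl
        by_cases h : l = i
        · subst h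
          rw [hupi]
          refine ⟨hCc, fun x hx => ?_⟩
          rcases hCD x hx with h | h
          · exact (hB _ hl).2 h
          · exact hDW h
        · rw [hup l h]
          exact hB l hl
      · intro k' hk' l hl hkl
        by_cases h : l = i
        · subst h
          rw [hupi, hup _ hkl]
          obtain ⟨h1, v, hv, w, hw, hvw⟩ := hBB k' hk' l hl hkl
          exact ⟨(hCB k' hk' hkl).symm, v, hv, w, hBC hw, hvw⟩
        · rw [hup l h]
          by_cases h' : k' = i
          · subst h'
            rw [hupi]
            obtain ⟨h1, v, hv, w, hw, hvw⟩ := hBB k' hk' l hl hkl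
            exact ⟨hCB l hl (Ne.symm hkl), v, hBC hv, w, hw, hvw⟩
          · rw [hup k' h']
            exact hBB k' hk' l hl hkl
      · intro x hx
        simp only [mem_union, mem_sdiff, mem_inter] at hx
        rcases hx with hx | hx
        · obtain ⟨l, hl, hxl⟩ := mem_biUnion.1 (hX hx.1)
          refine mem_biUnion.2 ⟨l, hl, ?_⟩
          rw [hup l (fun h => hx.2 (h ▸ hxl))]
          exact hxl
        · exact mem_biUnion.2 ⟨i, hi, by rw [hupi]; exact hx.2⟩
      · intro l hl
        by_cases h : l = i
        · subst h
          rw [hupi]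
          refine (card_le_card ?_).trans hZc
          intro x hx
          simp only [mem_inter, mem_union, mem_sdiff] at hx
          rcases hx with ⟨hx | hx, hxC⟩
          · rcases hCD x hxC with h | h
            · exact absurd h hx.2
            · exact absurd hx.1 (hDxX x h)
          · exact hx.1
        · rw [hup l h]
          refine (card_le_card ?_).trans (hXr l hl)
          intro x hx
          simp only [mem_inter, mem_union, mem_sdiff] at hx ⊢
          rcases hx with ⟨hx | hx, hxB⟩
          · exact ⟨hx.1, hxB⟩
          · exact absurd hxB (disjoint_left.1 (hCB l hl h) hx.2)
      · intro l hl
        by_cases h : l = i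
        · subst h
          rw [hupi]
          exact disjoint_of_subset_left hE'sub sdiff_disjoint
        · rw [hup l h]
          exact disjoint_of_subset_left (hE'sub.trans sdiff_subset) (hDB l hl)
      · obtain ⟨x, hx⟩ := ha i hi
        simp only [hA, mem_filter] at hx
        obtain ⟨hxD, w, hw, hxw⟩ := hx
        have hxE : x ∉ E := fun h => hEi' x h w hw hxw
        have hxC : x ∈ C := hCcl w (hBC hw) x (mem_union_right _ (mem_sdiff.2 ⟨hxD, hxE⟩))
          (hs _ _ hxw)
        have : E'.card < D.card := card_lt_card
          (_root_.ssubset_of_subset_of_ssubset hE'sub ⟨sdiff_subset, fun h => (mem_sdiff.1 (h hxD)).2 hxC⟩)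
        omega

/-- The separator theorem. -/
theorem separator (hs : ∀ v w, adj v w → adj w v) (W : Finset V) (hW : 1 ≤ W.card)
    (hK : ¬ K5Minor adj W) :
    ∃ Z W₁ W₂ : Finset V, W = Z ∪ (W₁ ∪ W₂) ∧ Disjoint Z W₁ ∧ Disjoint Z W₂ ∧ Disjoint W₁ W₂ ∧
      (∀ v ∈ W₁, ∀ w ∈ W₂, ¬ adj v w) ∧ 3 * W₁.card ≤ 2 * W.card ∧ 3 * W₂.card ≤ 2 * W.card ∧
      Z.card ^ 2 ≤ 1000 * W.card := by
  set r := Nat.sqrt (6 * W.card) + 1 with hr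
  have hr1 : 6 * W.card ≤ r * r := (Nat.lt_succ_sqrt _).le
  have hr2 : (r - 1) * (r - 1) ≤ 6 * W.card := by
    simp only [hr, Nat.add_sub_cancel]
    exact Nat.sqrt_le _
  have hr3 : (6 * r) ^ 2 ≤ 1000 * W.card := by
    have : r - 1 = Nat.sqrt (6 * W.card) := rfl
    obtain ⟨q, hq⟩ : ∃ q, r = q + 1 := ⟨_, hr⟩
    rw [hq] at hr2 ⊢
    simp only [Nat.add_sub_cancel] at hr2
    have : 1 ≤ q := by
      by_contra h
      have hq0 : q = 0 := by omega
      rw [hq, hq0] at hr1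
      omega
    nlinarith [sq_nonneg ((q:ℤ) - 1), Nat.sub_add_cancel this]
  obtain ⟨Z, hZW, hZc, hZ⟩ : ∃ Z ⊆ W, Z.card ≤ 6 * r ∧
      ∀ C ⊆ W \ Z, Conn adj C → ClosedIn adj (W \ Z) C → 2 * C.card ≤ W.card := by
    by_contra hc
    push Not at hc
    have H : ∀ X ⊆ W, X.card ≤ 6 * r → ∃ D, Big adj W X D := by
      intro X hX hXc
      obtain ⟨D, h1, h2, h3, h4⟩ := hc X hX hXc
      exact ⟨D, h1, h2, h3, h4⟩
    obtain ⟨D, hD⟩ := H ∅ (empty_subset _) (by simp)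
    exact hK (step hs W r (by omega) hr1 H _ ∅ (fun _ => ∅) ∅ D (by simp) (by simp) (by simp)
      (by simp) hD (by simp) le_rfl)
  have hZ2 : Z.card ^ 2 ≤ 1000 * W.card := (Nat.pow_le_pow_left hZc 2).trans hr3
  have fin : ∀ U ⊆ W \ Z, ClosedIn adj (W \ Z) U → 3 * U.card ≤ 2 * W.card →
      3 * ((W \ Z) \ U).card ≤ 2 * W.card → ∃ Z W₁ W₂ : Finset V, W = Z ∪ (W₁ ∪ W₂) ∧
      Disjoint Z W₁ ∧ Disjoint Z W₂ ∧ Disjoint W₁ W₂ ∧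
      (∀ v ∈ W₁, ∀ w ∈ W₂, ¬ adj v w) ∧ 3 * W₁.card ≤ 2 * W.card ∧ 3 * W₂.card ≤ 2 * W.card ∧
      Z.card ^ 2 ≤ 1000 * W.card := by
    intro U hU hUc h1 h2
    refine ⟨Z, U, (W \ Z) \ U, ?_, ?_, ?_, disjoint_sdiff, ?_, h1, h2, hZ2⟩
    · rw [union_sdiff_of_subset hU, union_sdiff_of_subset hZW]
    · exact (disjoint_of_subset_left hU sdiff_disjoint).symm
    · exact (disjoint_of_subset_left sdiff_subset sdiff_disjoint).symm
    · intro v hv w hw hvw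
      simp only [mem_sdiff] at hw
      exact hw.2 (hUc v hv w (by simp only [mem_sdiff]; tauto) hvw)
  obtain ⟨U, hUm, hUmax⟩ := exists_max_image
    ((W \ Z).powerset.filter (fun U => ClosedIn adj (W \ Z) U ∧ 3 * U.card ≤ 2 * W.card)) card
    ⟨∅, by simp [ClosedIn]⟩
  simp only [mem_filter, mem_powerset] at hUm hUmax
  obtain ⟨hU, hUc, hU3⟩ := hUm
  by_cases hR : 3 * ((W \ Z) \ U).card ≤ 2 * W.card
  · exact fin U hU hUc hU3 hR
  obtain ⟨v, hv⟩ : ((W \ Z) \ U).Nonempty := by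
    rw [← card_pos]
    omega
  have hCc : ClosedIn adj (W \ Z) (comp adj ((W \ Z) \ U) v) := by
    intro a ha w hw haw
    refine closed_comp hs a ha w (mem_sdiff.2 ⟨hw, fun hwU => ?_⟩) haw
    have := comp_sub _ _ ha
    exact (mem_sdiff.1 this).2 (hUc w hwU a (mem_sdiff.1 this).1 (hs _ _ haw))
  set C := comp adj ((W \ Z) \ U) v with hC
  have hCs : C ⊆ (W \ Z) \ U := comp_sub _ _
  have hCv : v ∈ C := mem_comp_self hv
  have hC2 : 2 * C.card ≤ W.card := hZ C (hCs.trans sdiff_subset) (conn_comp hv) hCc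
  have hUC : Disjoint U C := (disjoint_of_subset_left hCs sdiff_disjoint).symm
  have hUCc := card_union_of_disjoint hUC
  have hcard := card_sdiff_add_card_eq_card hU
  have hcard2 := card_le_card (sdiff_subset : W \ Z ⊆ W)
  have hcard3 := card_sdiff_add_card_eq_card (hCs.trans sdiff_subset)
  have hCp : 1 ≤ C.card := card_pos.2 ⟨v, hCv⟩
  by_cases h3 : 3 * (U ∪ C).card ≤ 2 * W.card
  · have := hUmax (U ∪ C) ⟨union_subset hU (hCs.trans sdiff_subset), by
      intro a ha w hw haw
      rcases mem_union.1 ha with h | h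
      · exact mem_union_left _ (hUc a h w hw haw)
      · exact mem_union_right _ (hCc a h w hw haw), h3⟩
    omega
  · exact fin C (hCs.trans sdiff_subset) hCc (by omega) (by omega)

end Sep

/-! ## Part 3: the abstract recursion -/

namespace Rec
open Classical Finset

theorem holder2 (a : ℝ) (ha : 0 < a) (ha1 : a < 1) (x₁ x₂ y₁ y₂ : ℝ) (hx₁ : 0 ≤ x₁) (hx₂ : 0 ≤ x₂)
    (hy₁ : 0 ≤ y₁) (hy₂ : 0 ≤ y₂) :
    x₁ ^ a * y₁ ^ (1 - a) + x₂ ^ a * y₂ ^ (1 - a) ≤ (x₁ + x₂) ^ a * (y₁ + y₂) ^ (1 - a) := by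
  have h1a : 1 - a ≠ 0 := by linarith
  rcases eq_or_lt_of_le (add_nonneg hx₁ hx₂) with hx | hx
  · have e1 : x₁ = 0 := by linarith
    have e2 : x₂ = 0 := by linarith
    simp [e1, e2, Real.zero_rpow ha.ne']
  rcases eq_or_lt_of_le (add_nonneg hy₁ hy₂) with hy | hy
  · have e1 : y₁ = 0 := by linarith
    have e2 : y₂ = 0 := by linarith
    simp [e1, e2, Real.zero_rpow h1a]
  have key : ∀ x y : ℝ, 0 ≤ x → 0 ≤ y → x ^ a * y ^ (1 - a) ≤
      (a * (x / (x₁ + x₂)) + (1 - a) * (y / (y₁ + y₂))) *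
        ((x₁ + x₂) ^ a * (y₁ + y₂) ^ (1 - a)) := by
    intro x y h1 h2
    have := Real.geom_mean_le_arith_mean2_weighted ha.le (by linarith : 0 ≤ 1 - a)
      (div_nonneg h1 hx.le) (div_nonneg h2 hy.le) (by ring)
    have h3 : x ^ a * y ^ (1 - a) = ((x / (x₁ + x₂)) ^ a * (y / (y₁ + y₂)) ^ (1 - a)) *
        ((x₁ + x₂) ^ a * (y₁ + y₂) ^ (1 - a)) := by
      rw [Real.div_rpow h1 hx.le, Real.div_rpow h2 hy.le]
      have := Real.rpow_pos_of_pos hx a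
      have := Real.rpow_pos_of_pos hy (1 - a)
      field_simp
    rw [h3]
    exact mul_le_mul_of_nonneg_right this (by positivity)
  have h1 := key x₁ y₁ hx₁ hy₁
  have h2 := key x₂ y₂ hx₂ hy₂
  have h3 : (a * (x₁ / (x₁ + x₂)) + (1 - a) * (y₁ / (y₁ + y₂))) +
      (a * (x₂ / (x₁ + x₂)) + (1 - a) * (y₂ / (y₁ + y₂))) = 1 := by
    field_simp
    ring
  calc _ ≤ _ := add_le_add h1 h2
    _ = _ := by rw [← add_mul, h3, one_mul]

/-- The damping factor in the induction. -/
def hfun (κ δ X : ℝ) : ℝ := 2 - min 1 (κ * X ^ (-δ))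

set_option maxHeartbeats 1000000 in
theorem internal (a δ κ A X N X₁ X₂ N₁ N₂ Z T T₁ T₂ : ℝ) (ha : 0 < a) (ha1 : a < 1) (hδ : 0 < δ)
    (hκ : 0 < κ) (hA : 1 ≤ A) (hX : 1 ≤ X) (hκ2 : 192 ≤ κ * ((3/2) ^ δ - 1))
    (hX0 : κ * (3/2) ^ δ * X ^ (-δ) ≤ 1)
    (hX₁ : X₁ = 0 ∨ 1 ≤ X₁) (hX₂ : X₂ = 0 ∨ 1 ≤ X₂) (hX₁X : 3 * X₁ ≤ 2 * X) (hX₂X : 3 * X₂ ≤ 2 * X)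
    (hXX : X₁ + X₂ ≤ X) (hN₁ : 0 ≤ N₁) (hN₂ : 0 ≤ N₂) (hN : N₁ + N₂ ≤ N + 2 * Z) (hN0 : 0 < N)
    (hNX : N ≤ 2 * X) (hZ0 : 0 ≤ Z) (hZ : Z ≤ 32 * X ^ (1/2 : ℝ)) (hNb : X ^ (1/2 + δ) ≤ N)
    (hT : T ≤ Z + T₁ + T₂) (hT₁ : T₁ ≤ A * hfun κ δ X₁ * (N₁ ^ a * X₁ ^ (1 - a)))
    (hT₂ : T₂ ≤ A * hfun κ δ X₂ * (N₂ ^ a * X₂ ^ (1 - a))) :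
    T ≤ A * hfun κ δ X * (N ^ a * X ^ (1 - a)) := by
  set u := X ^ (-δ) with hu
  set θ : ℝ := (3/2) ^ δ with hθ
  have hX0' : 0 < X := by linarith
  have hu0 : 0 < u := Real.rpow_pos_of_pos hX0' _
  have hθ1 : 1 ≤ θ := Real.one_le_rpow (by norm_num) hδ.le
  have hhX : hfun κ δ X = 2 - κ * u := by
    unfold hfun
    rw [min_eq_right]
    calc κ * u ≤ κ * θ * u := by
          apply mul_le_mul_of_nonneg_right _ hu0.le
          nlinarith
      _ ≤ 1 := hX0
  have hsmall : ∀ Y M S : ℝ, (Y = 0 ∨ 1 ≤ Y) → 3 * Y ≤ 2 * X → 0 ≤ M →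
      S ≤ A * hfun κ δ Y * (M ^ a * Y ^ (1 - a)) →
      S ≤ A * (2 - κ * θ * u) * (M ^ a * Y ^ (1 - a)) := by
    intro Y M S hY hYX hM hS
    rcases hY with rfl | hY
    · rw [Real.zero_rpow (by linarith : 1 - a ≠ 0)] at hS ⊢
      simpa using hS
    refine hS.trans (mul_le_mul_of_nonneg_right ?_ (by positivity))
    refine mul_le_mul_of_nonneg_left ?_ (by linarith)
    unfold hfun
    have : κ * θ * u ≤ min 1 (κ * Y ^ (-δ)) := by
      refine le_min hX0 ?_
      rw [mul_assoc]
      refine mul_le_mul_of_nonneg_left ?_ hκ.le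
      have h1 : ((2/3) * X) ^ (-δ) ≤ Y ^ (-δ) :=
        Real.rpow_le_rpow_of_nonpos (by linarith) (by linarith) (by linarith)
      have h2 : ((2/3) * X) ^ (-δ) = θ * u := by
        rw [Real.mul_rpow (by norm_num) hX0'.le, hθ, Real.rpow_neg (by norm_num),
          ← Real.inv_rpow (by norm_num)]
        norm_num
        exact Or.inl rfl
      rw [← h2]
      exact h1
    linarith
  have h1 := hsmall X₁ N₁ T₁ hX₁ hX₁X hN₁ hT₁
  have h2 := hsmall X₂ N₂ T₂ hX₂ hX₂X hN₂ hT₂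
  have hX₁0 : 0 ≤ X₁ := by rcases hX₁ with h | h <;> linarith
  have hX₂0 : 0 ≤ X₂ := by rcases hX₂ with h | h <;> linarith
  have hH0 : 0 ≤ 2 - κ * θ * u := by linarith
  have hZu : Z ≤ 32 * u * N := by
    have e : X ^ (1/2 : ℝ) = u * X ^ (1/2 + δ) := by
      rw [hu, ← Real.rpow_add hX0']
      congr 1
      ring
    rw [e] at hZ
    nlinarith
  set Q := N ^ a * X ^ (1 - a) with hQ
  have hQ0 : 0 < Q := by positivity
  have hNQ : N ≤ 2 * Q := by
    have e : N = N ^ a * N ^ (1 - a) := by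
      rw [← Real.rpow_add hN0]
      simp
    have e2 : N ^ (1 - a) ≤ 2 * X ^ (1 - a) := by
      calc N ^ (1 - a) ≤ (2 * X) ^ (1 - a) :=
            Real.rpow_le_rpow hN0.le hNX (by linarith)
        _ = 2 ^ (1 - a) * X ^ (1 - a) := Real.mul_rpow (by norm_num) hX0'.le
        _ ≤ 2 * X ^ (1 - a) := by
            refine mul_le_mul_of_nonneg_right ?_ (by positivity)
            calc (2:ℝ) ^ (1 - a) ≤ 2 ^ (1:ℝ) :=
                  Real.rpow_le_rpow_of_exponent_le (by norm_num) (by linarith)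
              _ = 2 := by simp
    have h3 : 0 ≤ N ^ a := by positivity
    rw [e, hQ]
    nlinarith
  have hsum : N₁ ^ a * X₁ ^ (1 - a) + N₂ ^ a * X₂ ^ (1 - a) ≤ (1 + 64 * u) * Q := by
    refine (holder2 a ha ha1 N₁ N₂ X₁ X₂ hN₁ hN₂ hX₁0 hX₂0).trans ?_
    have e1 : (N₁ + N₂) ^ a ≤ (1 + 64 * u) * N ^ a := by
      calc (N₁ + N₂) ^ a ≤ ((1 + 64 * u) * N) ^ a := by
            refine Real.rpow_le_rpow (by linarith) ?_ ha.le
            nlinarith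
        _ = (1 + 64 * u) ^ a * N ^ a := Real.mul_rpow (by positivity) hN0.le
        _ ≤ (1 + 64 * u) * N ^ a := by
            refine mul_le_mul_of_nonneg_right ?_ (by positivity)
            calc (1 + 64 * u) ^ a ≤ (1 + 64 * u) ^ (1:ℝ) :=
                  Real.rpow_le_rpow_of_exponent_le (by linarith) ha1.le
              _ = _ := by simp
    have e2 : (X₁ + X₂) ^ (1 - a) ≤ X ^ (1 - a) :=
      Real.rpow_le_rpow (by linarith) hXX (by linarith)
    calc _ ≤ ((1 + 64 * u) * N ^ a) * X ^ (1 - a) := mul_le_mul e1 e2 (by positivity) (by positivity)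
      _ = _ := by rw [hQ]; ring
  rw [hhX]
  have hA0 : 0 < A := by linarith
  calc T ≤ Z + T₁ + T₂ := hT
    _ ≤ 64 * u * Q + A * (2 - κ * θ * u) * ((1 + 64 * u) * Q) := by
        have : A * (2 - κ * θ * u) * (N₁ ^ a * X₁ ^ (1 - a) + N₂ ^ a * X₂ ^ (1 - a)) ≤
          A * (2 - κ * θ * u) * ((1 + 64 * u) * Q) :=
          mul_le_mul_of_nonneg_left hsum (by positivity)
        have : 32 * u * N ≤ 32 * u * (2 * Q) := mul_le_mul_of_nonneg_left hNQ (by positivity)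
        nlinarith
    _ ≤ A * (64 * u * Q) + A * (2 - κ * θ * u) * ((1 + 64 * u) * Q) := by
        have : 0 ≤ 64 * u * Q := by positivity
        nlinarith
    _ = A * Q * (64 * u + (2 - κ * θ * u) * (1 + 64 * u)) := by ring
    _ ≤ A * Q * (2 - κ * u) := by
        refine mul_le_mul_of_nonneg_left ?_ (by positivity)
        have : 0 ≤ κ * θ * u * u := by positivity
        nlinarith
    _ = A * (2 - κ * u) * Q := by ring

section graph

variable {V : Type*} {n : ℕ} (inc : Fin n → V → Prop) (τ : Fin n → V → ℝ)

/-- `q` immediately precedes `p` along the curve `i`. -/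
def Pred (i : Fin n) (q p : V) : Prop :=
  inc i q ∧ inc i p ∧ τ i q < τ i p ∧ ∀ v, inc i v → τ i q < τ i v → τ i p ≤ τ i v

/-- The arrangement graph. -/
def adj (p q : V) : Prop := ∃ i, Pred inc τ i p q ∨ Pred inc τ i q p

variable [Fintype V]

/-- Starting points of `W`. -/
def Start (W : Finset V) : Finset (Fin n × V) :=
  univ.filter fun p => p.2 ∈ W ∧ inc p.1 p.2 ∧ ∀ q ∈ W, ¬ Pred inc τ p.1 q p.2

/-- The curves which meet `W`. -/
def Meets (W : Finset V) : Finset (Fin n) := univ.filter fun i => ∃ v ∈ W, inc i v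

variable {inc τ}

theorem start_univ (hτ : ∀ i p q, inc i p → inc i q → τ i p = τ i q → p = q) :
    (Start inc τ (univ : Finset V)).card ≤ n := by
  have h : ∀ i p q, (i, p) ∈ Start inc τ (univ : Finset V) → (i, q) ∈ Start inc τ (univ : Finset V) →
      ¬ τ i p < τ i q := by
    intro i p q hp hq hlt
    simp only [Start, mem_filter, mem_univ, true_and] at hp hq
    obtain ⟨v, hv, hmax⟩ := exists_max_image (univ.filter fun v => inc i v ∧ τ i v < τ i q) (τ i)
      ⟨p, by simp [hp.1, hlt]⟩
    simp only [mem_filter, mem_univ, true_and] at hv hmax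
    refine hq.2 v trivial ⟨hv.1, hq.1, hv.2, fun w hw hvw => ?_⟩
    by_contra hc
    exact absurd (hmax w ⟨hw, by linarith⟩) (by linarith)
  calc _ ≤ (univ : Finset (Fin n)).card := by
        refine card_le_card_of_injOn Prod.fst (fun _ _ => by simp) ?_
        rintro ⟨i, p⟩ hp ⟨j, q⟩ hq hij
        simp only at hij
        subst hij
        have h1 := h i p q (by simpa using hp) (by simpa using hq)
        have h2 := h i q p (by simpa using hq) (by simpa using hp)
        simp only [Start, mem_filter, mem_univ, true_and, coe_filter, Set.mem_ofPred_eq] at hp hq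
        rw [hτ i p q hp.1 hq.1 (by linarith)]
    _ = n := by simp

theorem meets_le (W : Finset V) : (Meets inc W).card ≤ (Start inc τ W).card := by
  have : Meets inc W ⊆ (Start inc τ W).image Prod.fst := by
    intro i hi
    simp only [Meets, mem_filter, mem_univ, true_and] at hi
    obtain ⟨v, hv, hiv⟩ := hi
    obtain ⟨p, hp, hmin⟩ := exists_min_image (W.filter fun v => inc i v) (τ i)
      ⟨v, by simp [hv, hiv]⟩
    simp only [mem_filter] at hp hmin
    refine mem_image.2 ⟨(i, p), ?_, rfl⟩
    simp only [Start, mem_filter, mem_univ, true_and]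
    refine ⟨hp.1, hp.2, fun q hq hpred => ?_⟩
    exact absurd (hmin q ⟨hq, hpred.1⟩) (by linarith [hpred.2.2.1])
  exact (card_le_card this).trans card_image_le

theorem inc_card (h2 : ∀ v, (univ.filter fun i => inc i v).card ≤ 2) (Z : Finset V) :
    (univ.filter fun p : Fin n × V => p.2 ∈ Z ∧ inc p.1 p.2).card ≤ 2 * Z.card := by
  have := card_le_mul_card_image_of_maps_to (s := univ.filter fun p : Fin n × V => p.2 ∈ Z ∧ inc p.1 p.2)
    (t := Z) (f := Prod.snd) (fun p hp => by simp only [mem_filter] at hp; exact hp.2.1) 2 ?_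
  · exact this
  · intro z hz
    refine le_trans ?_ (h2 z)
    refine card_le_card_of_injOn Prod.fst ?_ ?_
    · rintro ⟨i, v⟩ hp
      simp only [mem_filter, mem_univ, true_and, coe_filter, Set.mem_ofPred_eq] at hp ⊢
      exact hp.2 ▸ hp.1.2
    · rintro ⟨i, v⟩ hp ⟨j, w⟩ hq hij
      simp only [mem_filter, mem_univ, true_and, coe_filter, Set.mem_ofPred_eq] at hp hq hij
      rw [hij, hp.2, hq.2]

theorem start_le (h2 : ∀ v, (univ.filter fun i => inc i v).card ≤ 2) (W : Finset V) :
    (Start inc τ W).card ≤ 2 * W.card := by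
  refine (card_le_card ?_).trans (inc_card h2 W)
  intro p hp
  simp only [Start, mem_filter, mem_univ, true_and] at hp ⊢
  exact ⟨hp.1, hp.2.1⟩

theorem start_split (hτ : ∀ i p q, inc i p → inc i q → τ i p = τ i q → p = q)
    (h2 : ∀ v, (univ.filter fun i => inc i v).card ≤ 2) (W Z W₁ W₂ : Finset V)
    (hW : W = Z ∪ (W₁ ∪ W₂)) (hd : Disjoint W₁ W₂)
    (hno : ∀ v ∈ W₁, ∀ w ∈ W₂, ¬ adj inc τ v w) :
    (Start inc τ W₁).card + (Start inc τ W₂).card ≤ (Start inc τ W).card + 2 * Z.card := by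
  have hdis : Disjoint (Start inc τ W₁) (Start inc τ W₂) := by
    refine disjoint_left.2 fun p h1 h2 => ?_
    simp only [Start, mem_filter, mem_univ, true_and] at h1 h2
    exact disjoint_left.1 hd h1.1 h2.1
  rw [← card_union_of_disjoint hdis]
  set A := Start inc τ W₁ ∪ Start inc τ W₂ with hA
  have hAZ : ∀ p ∈ A \ Start inc τ W, ∃ q ∈ Z, Pred inc τ p.1 q p.2 := by
    rintro ⟨i, p⟩ hp
    simp only [hA, Start, mem_sdiff, mem_union, mem_filter, mem_univ, true_and] at hp
    obtain ⟨hp, hpW⟩ := hp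
    have hpW' : p ∈ W := by
      rw [hW]
      simp only [mem_union]
      tauto
    have hinc : inc i p := by tauto
    have : ∃ q ∈ W, Pred inc τ i q p := by
      by_contra hc
      push Not at hc
      exact hpW ⟨hpW', hinc, hc⟩
    obtain ⟨q, hq, hqp⟩ := this
    refine ⟨q, ?_, hqp⟩
    rw [hW] at hq
    simp only [mem_union] at hq
    rcases hq with hq | hq | hq
    · exact hq
    · rcases hp with hp | hp
      · exact absurd hqp (hp.2.2 q hq)
      · exact absurd ⟨i, Or.inl hqp⟩ (hno q hq p hp.1)
    · rcases hp with hp | hp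
      · exact absurd ⟨i, Or.inr hqp⟩ (hno p hp.1 q hq)
      · exact absurd hqp (hp.2.2 q hq)
  have hcard : (A \ Start inc τ W).card ≤ 2 * Z.card := by
    refine le_trans ?_ (inc_card h2 Z)
    refine card_le_card_of_injOn
      (fun p => (p.1, if h : p ∈ A \ Start inc τ W then (hAZ p h).choose else p.2)) ?_ ?_
    · intro p hp
      simp only [mem_coe] at hp
      have := (hAZ p hp).choose_spec
      simp only [hp, dif_pos, coe_filter, mem_univ, true_and, Set.mem_ofPred_eq]
      exact ⟨this.1, this.2.1⟩
    · rintro ⟨i, p⟩ hp ⟨j, q⟩ hq hij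
      simp only [mem_coe] at hp hq
      simp only [hp, hq, dif_pos, Prod.mk.injEq] at hij
      obtain ⟨rfl, hij⟩ := hij
      have a1 := (hAZ _ hp).choose_spec.2
      have a2 := (hAZ _ hq).choose_spec.2
      rw [hij] at a1
      have b1 := a1.2.2.2 q a2.2.1 a2.2.2.1
      have b2 := a2.2.2.2 p a1.2.1 a1.2.2.1
      rw [hτ i p q a1.2.1 a2.2.1 (le_antisymm b1 b2)]
  have := card_le_card_sdiff_add_card (s := A) (t := Start inc τ W)
  omega

end graph
end Rec

namespace Rec
open Classical Finset

theorem adj_symm {V : Type*} {n : ℕ} {inc : Fin n → V → Prop} {τ : Fin n → V → ℝ} (v w : V)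
    (h : adj inc τ v w) : adj inc τ w v := by
  obtain ⟨i, h | h⟩ := h
  · exact ⟨i, Or.inr h⟩
  · exact ⟨i, Or.inl h⟩

set_option maxHeartbeats 1000000 in
theorem recursion (a σ C : ℝ) (ha : 0 < a) (haσ : a < σ) (hσ : σ ≤ 1) (hC : 0 ≤ C) :
    ∃ K : ℝ, 0 < K ∧ ∀ (V : Type) [Fintype V] (n : ℕ) (inc : Fin n → V → Prop)
      (τ : Fin n → V → ℝ) (touch : Finset V),
      (∀ i p q, inc i p → inc i q → τ i p = τ i q → p = q) →
      (∀ v, (univ.filter fun i => inc i v).card ≤ 2) →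
      (∀ v, ∃ i, inc i v) →
      (¬ Sep.K5Minor (adj inc τ) (univ : Finset V)) →
      (∀ W : Finset V, ((touch ∩ W).card : ℝ) ≤ C * ((Meets inc W).card : ℝ) ^ (2 - σ)) →
      (touch.card : ℝ) ≤ K * ((n : ℝ) ^ a * (Fintype.card V : ℝ) ^ (1 - a)) := by
  have ha1 : a < 1 := by linarith
  have hden : 0 < 2 - σ - a := by linarith
  obtain ⟨β, hβ⟩ : ∃ β, β = (1 - a) / (2 - σ - a) := ⟨_, rfl⟩
  have hβ' : β * (2 - σ - a) = 1 - a := by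
    rw [hβ]
    field_simp
  have hβ2 : 1/2 < β := by
    rw [hβ, lt_div_iff₀ hden]
    linarith
  obtain ⟨δ, hδ⟩ : ∃ δ, δ = β - 1/2 := ⟨_, rfl⟩
  have hδ0 : 0 < δ := by linarith
  have hθ : 1 < ((3:ℝ)/2) ^ δ := Real.one_lt_rpow (by norm_num) hδ0
  obtain ⟨κ, hκ⟩ : ∃ κ, κ = 192 / (((3:ℝ)/2) ^ δ - 1) := ⟨_, rfl⟩
  have hκ0 : 0 < κ := by
    rw [hκ]
    exact div_pos (by norm_num) (by linarith)
  have hκ2 : 192 ≤ κ * (((3:ℝ)/2) ^ δ - 1) := by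
    rw [hκ, div_mul_cancel₀]
    linarith
  have hpos : 0 < κ * ((3:ℝ)/2) ^ δ := by positivity
  obtain ⟨X0, hX0⟩ : ∃ X0 : ℝ, X0 = max 1 ((κ * ((3:ℝ)/2) ^ δ) ^ (1/δ)) := ⟨_, rfl⟩
  have hX0one : 1 ≤ X0 := by rw [hX0]; exact le_max_left _ _
  have hX0u : ∀ X : ℝ, X0 ≤ X → κ * (3/2) ^ δ * X ^ (-δ) ≤ 1 := by
    intro X hX
    have h1 : (κ * ((3:ℝ)/2) ^ δ) ^ (1/δ) ≤ X := by
      rw [hX0] at hX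
      exact (le_max_right _ _).trans hX
    have h2 : κ * ((3:ℝ)/2) ^ δ ≤ X ^ δ := by
      calc κ * ((3:ℝ)/2) ^ δ = ((κ * ((3:ℝ)/2) ^ δ) ^ (1/δ)) ^ δ := by
            rw [← Real.rpow_mul hpos.le]
            field_simp
            simp
        _ ≤ X ^ δ := Real.rpow_le_rpow (by positivity) h1 hδ0.le
    have h3 : 0 < X ^ δ := by linarith
    rw [Real.rpow_neg (by linarith), ← div_eq_mul_inv, div_le_one h3]
    exact h2
  obtain ⟨A, hA⟩ : ∃ A, A = max 1 (max (X0 ^ a) C) := ⟨_, rfl⟩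
  have hA1 : 1 ≤ A := by rw [hA]; exact le_max_left _ _
  have hA2 : X0 ^ a ≤ A := by rw [hA]; exact (le_max_left _ _).trans (le_max_right _ _)
  have hA3 : C ≤ A := by rw [hA]; exact (le_max_right _ _).trans (le_max_right _ _)
  have hh1 : ∀ X, 1 ≤ hfun κ δ X := by
    intro X
    unfold hfun
    linarith [min_le_left 1 (κ * X ^ (-δ))]
  have hh2 : ∀ X : ℝ, 0 ≤ X → hfun κ δ X ≤ 2 := by
    intro X hX
    unfold hfun
    have : 0 ≤ min 1 (κ * X ^ (-δ)) := le_min (by norm_num) (by positivity)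
    linarith
  refine ⟨2 * A, by linarith, ?_⟩
  intro V _ n inc τ touch hτ h2 h1 hK hleaf
  have main : ∀ k, ∀ W : Finset V, W.card = k → ((touch ∩ W).card : ℝ) ≤
      A * hfun κ δ (W.card : ℝ) *
        (((Start inc τ W).card : ℝ) ^ a * (W.card : ℝ) ^ (1 - a)) := by
    intro k
    induction k using Nat.strong_induction_on with
    | _ k ih =>
    intro W hWk
    rcases Nat.eq_zero_or_pos W.card with h0 | hWpos
    · have : W = ∅ := card_eq_zero.1 h0
      subst this
      simp [Real.zero_rpow (by linarith : 1 - a ≠ 0)]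
    have hX1 : (1:ℝ) ≤ W.card := by exact_mod_cast hWpos
    have hNM : (Meets inc W).card ≤ (Start inc τ W).card := meets_le W
    have hM1 : 1 ≤ (Meets inc W).card := by
      obtain ⟨v, hv⟩ := card_pos.1 hWpos
      obtain ⟨i, hi⟩ := h1 v
      exact card_pos.2 ⟨i, by simp only [Meets, mem_filter, mem_univ, true_and]; exact ⟨v, hv, hi⟩⟩
    have hN1 : (1:ℝ) ≤ (Start inc τ W).card := by exact_mod_cast hM1.trans hNM
    have hNX : ((Start inc τ W).card : ℝ) ≤ 2 * W.card := by exact_mod_cast start_le h2 W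
    have hNMR : ((Meets inc W).card : ℝ) ≤ (Start inc τ W).card := by exact_mod_cast hNM
    have hTX : ((touch ∩ W).card : ℝ) ≤ W.card := by
      exact_mod_cast card_le_card inter_subset_right
    set X : ℝ := (W.card : ℝ) with hXdef
    set N : ℝ := ((Start inc τ W).card : ℝ) with hNdef
    have hleafA : ((touch ∩ W).card : ℝ) ≤ A * (N ^ a * X ^ (1 - a)) →
        ((touch ∩ W).card : ℝ) ≤ A * hfun κ δ X * (N ^ a * X ^ (1 - a)) := by
      intro h
      refine h.trans ?_
      rw [mul_assoc A]
      refine mul_le_mul_of_nonneg_left ?_ (by linarith)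
      have : 0 ≤ N ^ a * X ^ (1 - a) := by positivity
      nlinarith [hh1 X]
    by_cases hXX0 : X ≤ X0
    · apply hleafA
      calc ((touch ∩ W).card : ℝ) ≤ X := hTX
        _ = X ^ a * X ^ (1 - a) := by
            rw [← Real.rpow_add (by linarith)]
            simp
        _ ≤ (A * N ^ a) * X ^ (1 - a) := by
            refine mul_le_mul_of_nonneg_right ?_ (by positivity)
            have e1 : X ^ a ≤ X0 ^ a := Real.rpow_le_rpow (by linarith) hXX0 ha.le
            have e2 : 1 ≤ N ^ a := Real.one_le_rpow hN1 ha.le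
            nlinarith
        _ = _ := by ring
    push Not at hXX0
    by_cases hNβ : N ≤ X ^ β
    · apply hleafA
      calc ((touch ∩ W).card : ℝ) ≤ C * ((Meets inc W).card : ℝ) ^ (2 - σ) := hleaf W
        _ ≤ C * N ^ (2 - σ) := by
            refine mul_le_mul_of_nonneg_left ?_ hC
            exact Real.rpow_le_rpow (by positivity) hNMR (by linarith)
        _ = C * (N ^ a * N ^ (2 - σ - a)) := by
            rw [← Real.rpow_add (by linarith)]
            congr 2
            ring
        _ ≤ C * (N ^ a * X ^ (1 - a)) := by
            refine mul_le_mul_of_nonneg_left ?_ hC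
            refine mul_le_mul_of_nonneg_left ?_ (by positivity)
            calc N ^ (2 - σ - a) ≤ (X ^ β) ^ (2 - σ - a) :=
                  Real.rpow_le_rpow (by linarith) hNβ hden.le
              _ = X ^ (1 - a) := by rw [← Real.rpow_mul (by linarith), hβ']
        _ ≤ A * (N ^ a * X ^ (1 - a)) := mul_le_mul_of_nonneg_right hA3 (by positivity)
    push Not at hNβ
    obtain ⟨Z, W₁, W₂, hW, hZ1, hZ2, h12, hno, hc1, hc2, hZc⟩ := Sep.separator
      (adj := adj inc τ) adj_symm W hWpos (fun ⟨B, hB, hB'⟩ =>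
        hK ⟨B, fun l => ⟨(hB l).1, subset_univ _⟩, hB'⟩)
    have hcard : Z.card + (W₁.card + W₂.card) = W.card := by
      rw [hW, card_union_of_disjoint (disjoint_union_right.2 ⟨hZ1, hZ2⟩),
        card_union_of_disjoint h12]
    have i1 := ih W₁.card (by omega) W₁ rfl
    have i2 := ih W₂.card (by omega) W₂ rfl
    have hsplit := start_split hτ h2 W Z W₁ W₂ hW h12 hno
    refine internal a δ κ A X N W₁.card W₂.card (Start inc τ W₁).card (Start inc τ W₂).card
      Z.card _ (touch ∩ W₁).card (touch ∩ W₂).card ha ha1 hδ0 hκ0 hA1 hX1 hκ2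
      (hX0u X hXX0.le) ?_ ?_ ?_ ?_ ?_ (by positivity) (by positivity) ?_ (by linarith) hNX
      (by positivity) ?_ ?_ ?_ i1 i2
    · rcases Nat.eq_zero_or_pos W₁.card with h | h
      · left; exact_mod_cast h
      · right; exact_mod_cast h
    · rcases Nat.eq_zero_or_pos W₂.card with h | h
      · left; exact_mod_cast h
      · right; exact_mod_cast h
    · rw [hXdef]; exact_mod_cast hc1
    · rw [hXdef]; exact_mod_cast hc2
    · rw [hXdef]; exact_mod_cast (by omega : W₁.card + W₂.card ≤ W.card)
    · rw [hNdef]; exact_mod_cast hsplit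
    · rw [← Real.sqrt_eq_rpow]
      have e1 : (Z.card : ℝ) ^ 2 ≤ 1000 * X := by rw [hXdef]; exact_mod_cast hZc
      have e2 : (32 * Real.sqrt X) ^ 2 = 1024 * X := by
        rw [mul_pow, Real.sq_sqrt (by linarith)]
        norm_num
      exact abs_le_of_sq_le_sq' (by rw [e2]; linarith) (by positivity) |>.2
    · have : 1/2 + δ = β := by linarith
      rw [this]
      exact hNβ.le
    · have : (touch ∩ W).card ≤ Z.card + (touch ∩ W₁).card + (touch ∩ W₂).card := by
        have hsub : touch ∩ W ⊆ (Z ∪ (touch ∩ W₁)) ∪ (touch ∩ W₂) := by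
          intro x hx
          rw [hW] at hx
          simp only [mem_inter, mem_union] at hx ⊢
          tauto
        refine (card_le_card hsub).trans ((card_union_le _ _).trans ?_)
        have := card_union_le Z (touch ∩ W₁)
        omega
      exact_mod_cast this
  have := main _ univ rfl
  rw [inter_univ, card_univ] at this
  refine this.trans ?_
  have e1 : ((Start inc τ (univ : Finset V)).card : ℝ) ^ a ≤ (n : ℝ) ^ a :=
    Real.rpow_le_rpow (by positivity) (by exact_mod_cast start_univ hτ) ha.le
  have e2 := hh2 (Fintype.card V : ℝ) (by positivity)
  have e3 := hh1 (Fintype.card V : ℝ)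
  refine mul_le_mul ?_ (mul_le_mul_of_nonneg_right e1 (by positivity)) (by positivity) (by linarith)
  nlinarith

end Rec

/-! ## Part 4: the Kővári–Sós–Turán theorem -/

namespace KST
open Classical Finset

theorem kst {α : Type*} (R : α → α → Prop) (s t : ℕ) (hs : 1 ≤ s)
    (hno : ∀ (a : Fin s → α) (b : Fin t → α), Function.Injective a → Function.Injective b →
      (∀ i j, R (a i) (b j)) → False) (M : Finset α) :
    (((M ×ˢ M).filter fun p => R p.1 p.2).card : ℝ) ≤
      ((s : ℝ) + t) * (M.card : ℝ) ^ (2 - 1 / (s : ℝ)) := by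
  have hs1 : (1:ℝ) ≤ s := by exact_mod_cast hs
  have h1s : 1 / (s:ℝ) ≤ 1 := by
    rw [div_le_one (by linarith)]
    exact hs1
  rcases Nat.eq_zero_or_pos M.card with h0 | hpos
  · rw [card_eq_zero.1 h0]
    simp only [empty_product, filter_empty, card_empty, Nat.cast_zero]
    positivity
  have hN1 : (1:ℝ) ≤ M.card := by exact_mod_cast hpos
  set nb : α → Finset α := fun y => M.filter fun x => R x y with hnb
  have hE : ((M ×ˢ M).filter fun p => R p.1 p.2).card = ∑ y ∈ M, (nb y).card := by
    rw [← card_sigma]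
    refine card_bij' (fun p _ => ⟨p.2, p.1⟩) (fun p _ => (p.2, p.1)) ?_ ?_ ?_ ?_
    · intro p hp
      simp only [mem_filter, mem_product, mem_sigma, hnb] at hp ⊢
      tauto
    · intro p hp
      simp only [mem_filter, mem_product, mem_sigma, hnb] at hp ⊢
      tauto
    · intro p _
      rfl
    · intro p _
      rfl
  have hcount : ∑ y ∈ M, (nb y).card.choose s ≤ t * M.card.choose s := by
    have h1 := sum_card_bipartiteAbove_eq_sum_card_bipartiteBelow (s := powersetCard s M) (t := M)
      (fun S y => S ⊆ nb y)
    have h2 : ∀ y ∈ M, (bipartiteBelow (fun S y => S ⊆ nb y) (powersetCard s M) y).card =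
        (nb y).card.choose s := by
      intro y hy
      rw [← card_powersetCard]
      congr 1
      ext S
      simp only [bipartiteBelow, mem_filter, mem_powersetCard]
      constructor
      · rintro ⟨⟨_, h⟩, h'⟩
        exact ⟨h', h⟩
      · rintro ⟨h, h'⟩
        exact ⟨⟨h.trans (filter_subset _ _), h'⟩, h⟩
    rw [sum_congr rfl h2] at h1
    rw [← h1]
    have h3 : ∀ S ∈ powersetCard s M, (bipartiteAbove (fun S y => S ⊆ nb y) M S).card ≤ t := by
      intro S hS
      by_contra hc
      push Not at hc
      obtain ⟨B, hB, hBt⟩ := exists_subset_card_eq hc.le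
      have hSs := (mem_powersetCard.1 hS).2
      refine hno (fun i => (S.equivFinOfCardEq hSs).symm i) (fun j => (B.equivFinOfCardEq hBt).symm j)
        (Subtype.val_injective.comp (Equiv.injective _))
        (Subtype.val_injective.comp (Equiv.injective _)) ?_
      intro i j
      have hj := hB ((B.equivFinOfCardEq hBt).symm j).2
      simp only [bipartiteAbove, mem_filter] at hj
      have := hj.2 ((S.equivFinOfCardEq hSs).symm i).2
      simp only [hnb, mem_filter] at this
      exact this.2
    refine (sum_le_card_nsmul _ _ t h3).trans ?_
    rw [card_powersetCard, smul_eq_mul, mul_comm]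
  have hdesc : ∑ y ∈ M, ((nb y).card + 1 - s) ^ s ≤ t * M.card ^ s := by
    calc ∑ y ∈ M, ((nb y).card + 1 - s) ^ s ≤ ∑ y ∈ M, (nb y).card.descFactorial s :=
          sum_le_sum fun y _ => Nat.pow_sub_le_descFactorial _ _
      _ = s.factorial * ∑ y ∈ M, (nb y).card.choose s := by
          rw [mul_sum]
          exact sum_congr rfl fun y _ => Nat.descFactorial_eq_factorial_mul_choose _ _
      _ ≤ s.factorial * (t * M.card.choose s) := Nat.mul_le_mul_left _ hcount
      _ = t * M.card.descFactorial s := by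
          rw [Nat.descFactorial_eq_factorial_mul_choose]
          ring
      _ ≤ t * M.card ^ s := Nat.mul_le_mul_left _ (Nat.descFactorial_le_pow _ _)
  obtain ⟨q, hq⟩ : ∃ q, s = q + 1 := ⟨s - 1, by omega⟩
  set F := ∑ y ∈ M, ((nb y).card + 1 - s) with hF
  have hpow : F ^ s ≤ t * M.card ^ (2 * s - 1) := by
    have h := pow_sum_le_card_mul_sum_pow (s := M) (f := fun y => (nb y).card + 1 - s)
      (fun _ _ => Nat.zero_le _) q
    rw [← hq] at h
    refine h.trans ((Nat.mul_le_mul_left _ hdesc).trans (le_of_eq ?_))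
    have : 2 * s - 1 = q + s := by omega
    rw [this, pow_add]
    push_cast
    ring
  have hEF : ((M ×ˢ M).filter fun p => R p.1 p.2).card ≤ s * M.card + F := by
    rw [hE, hF, mul_comm, ← smul_eq_mul, ← sum_const, ← sum_add_distrib]
    exact sum_le_sum fun y _ => by omega
  have hFR : (F : ℝ) ≤ t * (M.card : ℝ) ^ (2 - 1 / (s : ℝ)) := by
    have h1 : (F : ℝ) ^ s ≤ (t * (M.card : ℝ) ^ (2 - 1 / (s : ℝ))) ^ s := by
      have e : ((M.card : ℝ) ^ (2 - 1 / (s : ℝ))) ^ s = (M.card : ℝ) ^ (2 * s - 1) := by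
        rw [← Real.rpow_natCast, ← Real.rpow_mul (by positivity), ← Real.rpow_natCast]
        congr 1
        rw [Nat.cast_sub (by omega)]
        push_cast
        field_simp
      rw [mul_pow, e]
      have h2 : (F : ℝ) ^ s ≤ t * (M.card : ℝ) ^ (2 * s - 1) := by exact_mod_cast hpow
      refine h2.trans (mul_le_mul_of_nonneg_right ?_ (by positivity))
      exact_mod_cast Nat.le_self_pow (by omega) t
    exact le_of_pow_le_pow_left₀ (by omega) (by positivity) h1
  have hM : (M.card : ℝ) ≤ (M.card : ℝ) ^ (2 - 1 / (s : ℝ)) := by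
    conv_lhs => rw [← Real.rpow_one (M.card : ℝ)]
    exact Real.rpow_le_rpow_of_exponent_le hN1 (by linarith)
  calc (((M ×ˢ M).filter fun p => R p.1 p.2).card : ℝ) ≤ s * M.card + F := by exact_mod_cast hEF
    _ ≤ s * (M.card : ℝ) ^ (2 - 1 / (s : ℝ)) + t * (M.card : ℝ) ^ (2 - 1 / (s : ℝ)) := by
        have := mul_le_mul_of_nonneg_left hM (by linarith : (0:ℝ) ≤ s)
        linarith
    _ = _ := by ring

end KST

/-! ## Part 5: parametrised Jordan curves -/

/-- A periodic parametrisation of a closed curve. -/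
def Param (γ : Set Plane) (f : ℝ → Plane) : Prop :=
  Continuous f ∧ Set.range f = γ ∧ ∀ a b, f a = f b ↔ ∃ k : ℤ, a - b = k

theorem exists_param {γ : Set Plane} (h : IsJordanCurve γ) : ∃ f, Param γ f := by
  obtain ⟨e⟩ := h
  set c : ℝ → Plane := fun t => !₂[Real.cos (2 * Real.pi * t), Real.sin (2 * Real.pi * t)] with hc
  have hcc : Continuous c := by
    apply (PiLp.continuous_toLp 2 _).comp
    apply continuous_pi
    intro i
    fin_cases i
    · simp only [Fin.zero_eta, Matrix.cons_val_zero]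
      fun_prop
    · simp only [Fin.mk_one, Matrix.cons_val_one, Matrix.cons_val_fin_one]
      fun_prop
  have hcs : ∀ t, c t ∈ Metric.sphere (0 : Plane) 1 := by
    intro t
    simp [hc, EuclideanSpace.norm_eq]
  have hpi : (0:ℝ) < 2 * Real.pi := by positivity
  have hci : ∀ a b, c a = c b ↔ ∃ k : ℤ, a - b = k := by
    intro a b
    have h0 : ∀ k : ℤ, (2 * Real.pi * a - 2 * Real.pi * b = 2 * Real.pi * k ↔ a - b = k) := by
      intro k
      rw [← mul_sub]
      exact mul_right_inj' hpi.ne'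
    constructor
    · intro hab
      have h1 := congrArg (fun p : Plane => p 0) hab
      have h2 := congrArg (fun p : Plane => p 1) hab
      simp only [hc, PiLp.toLp_apply, Matrix.cons_val_zero, Matrix.cons_val_one,
        Matrix.cons_val_fin_one] at h1 h2
      have := Real.Angle.cos_sin_inj h1 h2
      obtain ⟨k, hk⟩ := Real.Angle.angle_eq_iff_two_pi_dvd_sub.1 this
      exact ⟨k, (h0 k).1 hk⟩
    · rintro ⟨k, hk⟩
      have e1 : 2 * Real.pi * a = 2 * Real.pi * b + k * (2 * Real.pi) := by
        rw [← (h0 k)] at hk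
        linarith
      simp only [hc, e1, Real.cos_add_int_mul_two_pi, Real.sin_add_int_mul_two_pi]
  have hsurj : ∀ p ∈ Metric.sphere (0 : Plane) 1, ∃ t, c t = p := by
    intro p hp
    simp only [mem_sphere_zero_iff_norm, EuclideanSpace.norm_eq, Fin.sum_univ_two,
      Real.norm_eq_abs, sq_abs, Real.sqrt_eq_one] at hp
    set z : ℂ := ⟨p 0, p 1⟩ with hz
    have hz1 : ‖z‖ = 1 := by
      rw [Complex.norm_def, Complex.normSq_apply, Real.sqrt_eq_one]
      simp only [hz]
      linarith
    refine ⟨Complex.arg z / (2 * Real.pi), ?_⟩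
    have h1 := Complex.norm_mul_cos_arg z
    have h2 := Complex.norm_mul_sin_arg z
    rw [hz1, one_mul] at h1 h2
    ext i
    fin_cases i
    · simp only [hc]
      rw [mul_div_cancel₀ _ hpi.ne']
      simpa using h1
    · simp only [hc]
      rw [mul_div_cancel₀ _ hpi.ne']
      simpa using h2
  refine ⟨fun t => e.symm ⟨c t, hcs t⟩, ?_, ?_, ?_⟩
  · exact continuous_subtype_val.comp (e.symm.continuous.comp (hcc.subtype_mk _))
  · ext p
    constructor
    · rintro ⟨t, rfl⟩
      exact (e.symm _).2
    · intro hp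
      obtain ⟨t, ht⟩ := hsurj _ (e ⟨p, hp⟩).2
      refine ⟨t, ?_⟩
      have : (⟨c t, hcs t⟩ : Metric.sphere (0 : Plane) 1) = e ⟨p, hp⟩ := Subtype.ext ht
      simp only [this, Homeomorph.symm_apply_apply]
  · intro a b
    rw [← hci]
    rw [Subtype.val_injective.eq_iff, e.symm.injective.eq_iff, Subtype.mk.injEq]

namespace Param
variable {γ : Set Plane} {f : ℝ → Plane}

theorem mem (h : Param γ f) (t : ℝ) : f t ∈ γ := h.2.1 ▸ ⟨t, rfl⟩

theorem inj (h : Param γ f) {a b s : ℝ} (ha : a ∈ Set.Ico s (s+1)) (hb : b ∈ Set.Ico s (s+1))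
    (hab : f a = f b) : a = b := by
  obtain ⟨k, hk⟩ := (h.2.2 a b).1 hab
  have h1 : (k:ℝ) < 1 := by linarith [ha.2, hb.1]
  have h2 : (-1:ℝ) < k := by linarith [ha.1, hb.2]
  have h3 : k < 1 := by exact_mod_cast h1
  have h4 : -1 < k := by exact_mod_cast h2
  have : k = 0 := by omega
  rw [this] at hk
  push_cast at hk
  linarith

theorem surj (h : Param γ f) (s : ℝ) {p : Plane} (hp : p ∈ γ) : ∃ t ∈ Set.Ico s (s+1), f t = p := by
  rw [← h.2.1] at hp
  obtain ⟨t, rfl⟩ := hp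
  refine ⟨s + Int.fract (t - s), ⟨by linarith [Int.fract_nonneg (t - s)], by
    linarith [Int.fract_lt_one (t - s)]⟩, ?_⟩
  rw [h.2.2]
  refine ⟨-⌊t - s⌋, ?_⟩
  rw [Int.fract]
  push_cast
  ring

theorem joined_image (h : Param γ f) {S : Set ℝ} (hS : Convex ℝ S) {a b : ℝ} (ha : a ∈ S)
    (hb : b ∈ S) : JoinedIn (f '' S) (f a) (f b) :=
  ((hS.isPathConnected ⟨a, ha⟩).image h.1).joinedIn _ ⟨a, ha, rfl⟩ _ ⟨b, hb, rfl⟩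

theorem joined_compl (h : Param γ f) {p q r : Plane} (hp : p ∈ γ) (hq : q ∈ γ) (hr : r ∈ γ)
    (hpr : p ≠ r) (hqr : q ≠ r) : JoinedIn (γ \ {r}) p q := by
  obtain ⟨s, -, rfl⟩ := h.surj 0 hr
  have hlt : ∀ p ∈ γ, p ≠ f s → ∃ t ∈ Set.Ioo s (s+1), f t = p := by
    intro p hp hps
    obtain ⟨t, ht, rfl⟩ := h.surj s hp
    refine ⟨t, ⟨lt_of_le_of_ne ht.1 ?_, ht.2⟩, rfl⟩
    rintro rfl
    exact hps rfl
  obtain ⟨a, ha, rfl⟩ := hlt p hp hpr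
  obtain ⟨b, hb, rfl⟩ := hlt q hq hqr
  refine (h.joined_image (convex_Ioo s (s+1)) ha hb).mono ?_
  rintro _ ⟨t, ht, rfl⟩
  refine ⟨h.mem t, fun hts => ?_⟩
  have := h.inj (Set.Ioo_subset_Ico_self ht) (Set.left_mem_Ico.2 (by linarith)) hts
  exact absurd ht.1 (by rw [this]; exact lt_irrefl _)

end Param

/-! ## Part 6: no large complete bipartite touching pattern -/

theorem core_pattern (p1 p2 p3 : Fin 3 → Plane) (L R : Fin 3 → Set Plane) (e1 e3 a2 b0 : Set Plane)
    (hL : ∀ k, JoinedIn (L k) (p1 k) (p2 k)) (hR : ∀ k, JoinedIn (R k) (p2 k) (p3 k))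
    (he1 : ∀ k, JoinedIn e1 (p1 0) (p1 k)) (he3 : ∀ k, JoinedIn e3 (p3 k) (p3 0))
    (ha2 : ∀ k l j, j ≠ k → j ≠ l → JoinedIn (a2 \ {p2 j}) (p2 k) (p2 l))
    (hb0 : JoinedIn (b0 \ {p2 0}) (p1 0) (p3 0))
    (d1 : Disjoint e1 a2) (d2 : Disjoint e3 a2) (d3 : Disjoint e1 e3)
    (d4 : ∀ k, Disjoint e1 (R k)) (d5 : ∀ k, Disjoint e3 (L k))
    (d6 : ∀ k l, k ≠ l → Disjoint (L k) (R l))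
    (d7 : ∀ k, a2 ∩ L k ⊆ {p2 k}) (d8 : ∀ k, a2 ∩ R k ⊆ {p2 k})
    (d9 : a2 ∩ b0 ⊆ {p2 0}) : False := by
  have f7 : ∀ k, Disjoint (L k) (a2 \ {p2 k}) := fun k =>
    Set.disjoint_left.2 fun x hx hx2 => hx2.2 (d7 k ⟨hx2.1, hx⟩)
  have f8 : ∀ k, Disjoint (R k) (a2 \ {p2 k}) := fun k =>
    Set.disjoint_left.2 fun x hx hx2 => hx2.2 (d8 k ⟨hx2.1, hx⟩)
  have g1 : ∀ S, Disjoint e1 (a2 \ S) := fun S => d1.mono_right Set.sdiff_subset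
  have g2 : ∀ S, Disjoint e3 (a2 \ S) := fun S => d2.mono_right Set.sdiff_subset
  have f9 : ∀ S, Disjoint (b0 \ {p2 0}) (a2 \ S) := fun S =>
    Set.disjoint_left.2 fun x hx hx2 => hx.2 (d9 ⟨hx2.1, hx.1⟩)
  set E : Fin 5 → Fin 5 → Set Plane :=
    ![![∅, e1 ∪ L 1, L 0, e1 ∪ L 2, b0 \ {p2 0}],
      ![∅, ∅, a2 \ {p2 2}, a2 \ {p2 0}, R 1 ∪ e3],
      ![∅, ∅, ∅, a2 \ {p2 1}, R 0],
      ![∅, ∅, ∅, ∅, R 2 ∪ e3],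
      ![∅, ∅, ∅, ∅, ∅]] with hE
  have j01 : JoinedIn (E 0 1) (p1 0) (p2 1) :=
    ((he1 1).mono Set.subset_union_left).trans ((hL 1).mono Set.subset_union_right)
  have j02 : JoinedIn (E 0 2) (p1 0) (p2 0) := hL 0
  have j03 : JoinedIn (E 0 3) (p1 0) (p2 2) :=
    ((he1 2).mono Set.subset_union_left).trans ((hL 2).mono Set.subset_union_right)
  have j04 : JoinedIn (E 0 4) (p1 0) (p3 0) := hb0
  have j12 : JoinedIn (E 1 2) (p2 1) (p2 0) := ha2 1 0 2 (by decide) (by decide)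
  have j13 : JoinedIn (E 1 3) (p2 1) (p2 2) := ha2 1 2 0 (by decide) (by decide)
  have j14 : JoinedIn (E 1 4) (p2 1) (p3 0) :=
    ((hR 1).mono Set.subset_union_left).trans ((he3 1).mono Set.subset_union_right)
  have j23 : JoinedIn (E 2 3) (p2 0) (p2 2) := ha2 0 2 1 (by decide) (by decide)
  have j24 : JoinedIn (E 2 4) (p2 0) (p3 0) := hR 0
  have j34 : JoinedIn (E 3 4) (p2 2) (p3 0) :=
    ((hR 2).mono Set.subset_union_left).trans ((he3 2).mono Set.subset_union_right)
  have d6' : ∀ k l, k ≠ l → Disjoint (R k) (L l) := fun k l h => (d6 l k h.symm).symm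
  have d4' : ∀ k, Disjoint (R k) e1 := fun k => (d4 k).symm
  have d5' : ∀ k, Disjoint (L k) e3 := fun k => (d5 k).symm
  have c0123 : Disjoint (E 0 1) (E 2 3) := Disjoint.union_left (g1 _) (f7 1)
  have c0124 : Disjoint (E 0 1) (E 2 4) := Disjoint.union_left (d4 0) (d6 1 0 (by decide))
  have c0134 : Disjoint (E 0 1) (E 3 4) :=
    Disjoint.union_left (Disjoint.union_right (d4 2) d3)
      (Disjoint.union_right (d6 1 2 (by decide)) (d5' 1))
  have c0213 : Disjoint (E 0 2) (E 1 3) := f7 0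
  have c0214 : Disjoint (E 0 2) (E 1 4) := Disjoint.union_right (d6 0 1 (by decide)) (d5' 0)
  have c0234 : Disjoint (E 0 2) (E 3 4) := Disjoint.union_right (d6 0 2 (by decide)) (d5' 0)
  have c0312 : Disjoint (E 0 3) (E 1 2) := Disjoint.union_left (g1 _) (f7 2)
  have c0314 : Disjoint (E 0 3) (E 1 4) :=
    Disjoint.union_left (Disjoint.union_right (d4 1) d3)
      (Disjoint.union_right (d6 2 1 (by decide)) (d5' 2))
  have c0324 : Disjoint (E 0 3) (E 2 4) := Disjoint.union_left (d4 0) (d6 2 0 (by decide))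
  have c0412 : Disjoint (E 0 4) (E 1 2) := f9 _
  have c0413 : Disjoint (E 0 4) (E 1 3) := f9 _
  have c0423 : Disjoint (E 0 4) (E 2 3) := f9 _
  have c1234 : Disjoint (E 1 2) (E 3 4) := (Disjoint.union_left (f8 2) (g2 _)).symm
  have c1324 : Disjoint (E 1 3) (E 2 4) := (f8 0).symm
  have c1423 : Disjoint (E 1 4) (E 2 3) := Disjoint.union_left (f8 1) (g2 _)
  refine K5_plane ![p1 0, p2 1, p2 0, p2 2, p3 0] E ?_ ?_
  · intro i j hij
    clear_value E
    fin_cases i <;> fin_cases j <;> first | exact absurd hij (by decide) | assumption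
  · intro i j k l hij hkl h1 h2 h3 h4
    clear_value E
    fin_cases i <;> fin_cases j <;> first | exact absurd hij (by decide) | skip
    all_goals
      fin_cases k <;> fin_cases l <;>
      first
      | exact absurd hkl (by decide)
      | exact absurd rfl h1
      | exact absurd rfl h2
      | exact absurd rfl h3
      | exact absurd rfl h4
      | assumption
      | (apply Disjoint.symm; assumption)

/-- Three curves of the second class with compatible combinatorial data are impossible. -/
theorem no_triple (m : ℕ) (α : Fin (9 * m + 3) → Set Plane) (β : Fin 3 → Set Plane)
    (g : Fin (9 * m + 3) → ℝ → Plane) (hg : ∀ i, Param (α i) (g i))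
    (f : Fin 3 → ℝ → Plane) (hf : ∀ j, Param (β j) (f j))
    (p : Fin (9 * m + 3) → Fin 3 → Plane) (hp : ∀ i j, α i ∩ β j = {p i j})
    (h3b : ∀ i j k, k ≠ j → p i j ∉ β k)
    (hββ : ∀ j k, j ≠ k → (β j ∩ β k).Finite ∧ (β j ∩ β k).ncard ≤ m)
    (u : Fin (9 * m + 3) → Fin 3 → ℝ) (hu : ∀ i j, u i j ∈ Set.Ico (0:ℝ) 1)
    (hgu : ∀ i j, g i (u i j) = p i j)
    (t : Fin (9 * m + 3) → Fin 3 → ℝ) (ht : ∀ i j, t i j ∈ Set.Ico (0:ℝ) 1)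
    (hft : ∀ i j, f j (t i j) = p i j)
    (hlab : ∀ i k, k ≠ i → ∀ j j' : Fin 3, ∀ v ∈ Set.Ico (0:ℝ) 1, u i j ≤ v → v ≤ u i j' → g i v ∉ α k)
    (hord : ∀ i k, i < k → ∀ j, t i j < t k j) : False := by
  classical
  have hpa : ∀ i j, p i j ∈ α i := fun i j => by
    have : p i j ∈ α i ∩ β j := by rw [hp]; rfl
    exact this.1
  have hpb : ∀ i j, p i j ∈ β j := fun i j => by
    have : p i j ∈ α i ∩ β j := by rw [hp]; rfl
    exact this.2
  have huniq : ∀ i j x, x ∈ α i → x ∈ β j → x = p i j := fun i j x h1 h2 => by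
    have : x ∈ α i ∩ β j := ⟨h1, h2⟩
    rw [hp] at this
    exact this
  have h01 : ∀ {x : ℝ}, x ∈ Set.Ico (0:ℝ) 1 → x ∈ Set.Ico (0:ℝ) (0 + 1) := by
    intro x hx
    simpa using hx
  -- windows
  let I : Fin 3 → Fin (3 * m + 1) → Fin (9 * m + 3) := fun c w => ⟨3 * w + c, by omega⟩
  let Seg : Fin 3 → Fin (3 * m + 1) → Set Plane := fun k w =>
    f k '' Set.Icc (t (I 0 w) k) (t (I 2 w) k)
  have hSegB : ∀ k w, Seg k w ⊆ β k := by
    rintro k w _ ⟨x, -, rfl⟩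
    exact (hf k).mem x
  have hIcc : ∀ k i j x, x ∈ Set.Icc (t i k) (t j k) → x ∈ Set.Ico (0:ℝ) (0+1) := by
    intro k i j x hx
    exact h01 ⟨(ht i k).1.trans hx.1, hx.2.trans_lt (ht j k).2⟩
  have hSegD : ∀ k w w', w < w' → ∀ x ∈ Seg k w, x ∉ Seg k w' := by
    rintro k w w' hww _ ⟨x, hx, rfl⟩ ⟨y, hy, hxy⟩
    have := (hf k).inj (hIcc k _ _ y hy) (hIcc k _ _ x hx) hxy
    have h1 : t (I 2 w) k < t (I 0 w') k := hord _ _ (by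
      have : (w : ℕ) < w' := hww
      simp only [I, Fin.lt_def]
      simp
      omega) k
    linarith [hx.2, hy.1]
  let bad : Fin 3 → Fin 3 → Finset (Fin (3 * m + 1)) := fun k l =>
    Finset.univ.filter fun w => (Seg k w ∩ Seg l w).Nonempty
  have hbad : ∀ k l, k ≠ l → (bad k l).card ≤ m := by
    intro k l hkl
    obtain ⟨hfin, hcard⟩ := hββ k l hkl
    rw [Set.ncard_eq_toFinset_card _ hfin] at hcard
    refine le_trans ?_ hcard
    refine Finset.card_le_card_of_injOn
      (fun w => if h : (Seg k w ∩ Seg l w).Nonempty then h.some else 0) ?_ ?_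
    · intro w hw
      simp only [bad, Finset.coe_filter, Finset.mem_univ, true_and, Set.mem_ofPred_eq] at hw
      simp only [hw, dif_pos, Set.Finite.coe_toFinset]
      exact ⟨hSegB _ _ hw.some_mem.1, hSegB _ _ hw.some_mem.2⟩
    · intro w hw w' hw' heq
      simp only [bad, Finset.coe_filter, Finset.mem_univ, true_and, Set.mem_ofPred_eq] at hw hw'
      simp only [hw, hw', dif_pos] at heq
      by_contra hne
      rcases lt_or_gt_of_ne hne with h | h
      · refine hSegD k w w' h _ hw.some_mem.1 ?_
        rw [heq]
        exact hw'.some_mem.1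
      · refine hSegD k w' w h _ hw'.some_mem.1 ?_
        rw [← heq]
        exact hw.some_mem.1
  obtain ⟨w, hw⟩ : ∃ w, w ∉ bad 0 1 ∪ (bad 0 2 ∪ bad 1 2) := by
    by_contra hc
    push Not at hc
    have h1 : (Finset.univ : Finset (Fin (3 * m + 1))).card ≤ (bad 0 1 ∪ (bad 0 2 ∪ bad 1 2)).card :=
      Finset.card_le_card fun w _ => hc w
    have h2 := Finset.card_union_le (bad 0 1) (bad 0 2 ∪ bad 1 2)
    have h3 := Finset.card_union_le (bad 0 2) (bad 1 2)
    have h4 := hbad 0 1 (by decide)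
    have h5 := hbad 0 2 (by decide)
    have h6 := hbad 1 2 (by decide)
    simp only [Finset.card_univ, Fintype.card_fin] at h1
    omega
  have hSS : ∀ k l, k ≠ l → Disjoint (Seg k w) (Seg l w) := by
    simp only [bad, Finset.mem_union, Finset.mem_filter, Finset.mem_univ, true_and, not_or,
      Set.not_nonempty_iff_eq_empty, ← Set.disjoint_iff_inter_eq_empty] at hw
    obtain ⟨h1, h2, h3⟩ := hw
    intro k l hkl
    fin_cases k <;> fin_cases l <;>
    first
    | exact absurd rfl hkl
    | exact h1
    | exact h2
    | exact h3
    | exact h1.symm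
    | exact h2.symm
    | exact h3.symm
  set i1 := I 0 w with hi1
  set i2 := I 1 w with hi2
  set i3 := I 2 w with hi3
  have l12 : i1 < i2 := by
    simp only [hi1, hi2, I, Fin.lt_def]
    simp
  have l23 : i2 < i3 := by
    simp only [hi2, hi3, I, Fin.lt_def]
    simp
  have l13 : i1 < i3 := l12.trans l23
  let U : Fin (9 * m + 3) → Set ℝ := fun i => {v | (∃ j, u i j ≤ v) ∧ ∃ j, v ≤ u i j}
  have hUc : ∀ i, Convex ℝ (U i) := by
    intro i
    apply Set.OrdConnected.convex
    constructor
    rintro x ⟨⟨j, hj⟩, -⟩ y ⟨-, ⟨j', hj'⟩⟩ z hz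
    exact ⟨⟨j, hj.trans hz.1⟩, ⟨j', hz.2.trans hj'⟩⟩
  have hUu : ∀ i j, u i j ∈ U i := fun i j => ⟨⟨j, le_rfl⟩, ⟨j, le_rfl⟩⟩
  have hUd : ∀ i k, k ≠ i → Disjoint (g i '' U i) (α k) := by
    intro i k hki
    refine Set.disjoint_left.2 ?_
    rintro _ ⟨v, ⟨⟨j, hj⟩, ⟨j', hj'⟩⟩, rfl⟩
    exact hlab i k hki j j' v ⟨(hu i j).1.trans hj, hj'.trans_lt (hu i j').2⟩ hj hj'
  have hUa : ∀ i, g i '' U i ⊆ α i := by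
    rintro i _ ⟨v, -, rfl⟩
    exact (hg i).mem v
  have hUj : ∀ i j j', JoinedIn (g i '' U i) (p i j) (p i j') := by
    intro i j j'
    have := (hg i).joined_image (hUc i) (hUu i j) (hUu i j')
    rwa [hgu, hgu] at this
  have hpne : ∀ i j k, j ≠ k → p i j ≠ p i k := by
    intro i j k hjk h
    exact h3b i j k hjk.symm (h ▸ hpb i k)
  have hpne2 : ∀ i k j, i < k → p i j ≠ p k j := by
    intro i k j hik h
    rw [← hft, ← hft] at h
    have := (hf j).inj (h01 (ht i j)) (h01 (ht k j)) h
    linarith [hord i k hik j]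
  have hsubL : ∀ k, f k '' Set.Icc (t i1 k) (t i2 k) ⊆ Seg k w := fun k =>
    Set.image_mono (Set.Icc_subset_Icc_right (hord _ _ l23 k).le)
  have hsubR : ∀ k, f k '' Set.Icc (t i2 k) (t i3 k) ⊆ Seg k w := fun k =>
    Set.image_mono (Set.Icc_subset_Icc_left (hord _ _ l12 k).le)
  refine core_pattern (p i1) (p i2) (p i3) (fun k => f k '' Set.Icc (t i1 k) (t i2 k))
    (fun k => f k '' Set.Icc (t i2 k) (t i3 k)) (g i1 '' U i1) (g i3 '' U i3) (α i2) (β 0)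
    ?_ ?_ (fun k => hUj i1 0 k) (fun k => hUj i3 k 0) ?_ ?_ (hUd i1 i2 l12.ne')
    (hUd i3 i2 l23.ne) ((hUd i1 i3 l13.ne').mono_right (hUa i3)) ?_ ?_ ?_ ?_ ?_ ?_
  · intro k
    have := (hf k).joined_image (convex_Icc (t i1 k) (t i2 k))
      (Set.left_mem_Icc.2 (hord _ _ l12 k).le) (Set.right_mem_Icc.2 (hord _ _ l12 k).le)
    rwa [hft, hft] at this
  · intro k
    have := (hf k).joined_image (convex_Icc (t i2 k) (t i3 k))
      (Set.left_mem_Icc.2 (hord _ _ l23 k).le) (Set.right_mem_Icc.2 (hord _ _ l23 k).le)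
    rwa [hft, hft] at this
  · intro k l j hjk hjl
    exact (hg i2).joined_compl (hpa _ _) (hpa _ _) (hpa _ _) (hpne _ _ _ hjk.symm)
      (hpne _ _ _ hjl.symm)
  · exact (hf 0).joined_compl (hpb _ _) (hpb _ _) (hpb _ _) (hpne2 _ _ _ l12) (hpne2 _ _ _ l23).symm
  · intro k
    refine Set.disjoint_left.2 fun x hx hx2 => ?_
    have e := huniq i1 k x (hUa _ hx) (hSegB _ _ (hsubR k hx2))
    obtain ⟨y, hy, rfl⟩ := hx2
    rw [← hft] at e
    have := (hf k).inj (hIcc k _ _ y hy) (h01 (ht _ _)) e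
    linarith [hord _ _ l12 k, hy.1]
  · intro k
    refine Set.disjoint_left.2 fun x hx hx2 => ?_
    have e := huniq i3 k x (hUa _ hx) (hSegB _ _ (hsubL k hx2))
    obtain ⟨y, hy, rfl⟩ := hx2
    rw [← hft] at e
    have := (hf k).inj (hIcc k _ _ y hy) (h01 (ht _ _)) e
    linarith [hord _ _ l23 k, hy.2]
  · intro k l hkl
    exact (hSS k l hkl).mono (hsubL k) (hsubR l)
  · rintro k x ⟨hx1, hx2⟩
    exact huniq i2 k x hx1 (hSegB _ _ (hsubL k hx2))
  · rintro k x ⟨hx1, hx2⟩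
    exact huniq i2 k x hx1 (hSegB _ _ (hsubR k hx2))
  · rintro x ⟨hx1, hx2⟩
    exact huniq i2 0 x hx1 hx2

/-- Combinatorial types used in the pigeonhole argument. -/
abbrev PatKey (m : ℕ) : Type :=
  (Fin (9 * m + 3) → Fin (9 * m + 3) → Bool) × (Fin (9 * m + 3) → Fin ((9 * m + 3) * m + 1))

theorem no_big_pattern (m : ℕ) {α : Fin (9 * m + 3) → Set Plane}
    {β : Fin (2 * Fintype.card (PatKey m) + 1) → Set Plane}
    (hα : ∀ i, IsJordanCurve (α i)) (hβ : ∀ j, IsJordanCurve (β j))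
    (hαα : ∀ i k, i ≠ k → (α i ∩ α k).Finite ∧ (α i ∩ α k).ncard ≤ m)
    (hββ : ∀ j k, j ≠ k → (β j ∩ β k).Finite ∧ (β j ∩ β k).ncard ≤ m)
    (htouch : ∀ i j, ∃ x, α i ∩ β j = {x})
    (h3a : ∀ x i j k, x ∈ α i → x ∈ β j → k ≠ i → x ∉ α k)
    (h3b : ∀ x i j k, x ∈ α i → x ∈ β j → k ≠ j → x ∉ β k) : False := by
  classical
  choose g hg using fun i => exists_param (hα i)
  choose f hf using fun j => exists_param (hβ j)
  choose p hp using htouch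
  have hpa : ∀ i j, p i j ∈ α i := fun i j => by
    have : p i j ∈ α i ∩ β j := by rw [hp]; rfl
    exact this.1
  have hpb : ∀ i j, p i j ∈ β j := fun i j => by
    have : p i j ∈ α i ∩ β j := by rw [hp]; rfl
    exact this.2
  choose u hu hgu using fun i j => (hg i).surj 0 (hpa i j)
  choose t ht hft using fun i j => (hf j).surj 0 (hpb i j)
  simp only [zero_add] at hu ht
  let F : Fin (9 * m + 3) → Set ℝ := fun i => {v | v ∈ Set.Ico (0:ℝ) 1 ∧ ∃ k, k ≠ i ∧ g i v ∈ α k}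
  have hFinj : ∀ i, Set.InjOn (g i) (F i) := by
    intro i x hx y hy hxy
    exact (hg i).inj (s := 0) (by simpa using hx.1) (by simpa using hy.1) hxy
  let P : Fin (9 * m + 3) → Finset Plane := fun i => Finset.univ.biUnion fun k =>
    if h : i ≠ k then (hαα i k h).1.toFinset else ∅
  have hFP : ∀ i, g i '' F i ⊆ P i := by
    rintro i _ ⟨v, ⟨hv, k, hk, hvk⟩, rfl⟩
    simp only [P, Finset.coe_biUnion, Set.mem_iUnion]
    refine ⟨k, Finset.mem_coe.2 (Finset.mem_univ _), ?_⟩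
    rw [dif_pos hk.symm]
    simp only [Set.Finite.coe_toFinset]
    exact ⟨(hg i).mem v, hvk⟩
  have hPc : ∀ i, (P i).card ≤ (9 * m + 3) * m := by
    intro i
    refine Finset.card_biUnion_le.trans ?_
    refine (Finset.sum_le_card_nsmul _ _ m ?_).trans (by simp)
    intro k _
    split_ifs with h
    · rw [← Set.ncard_eq_toFinset_card _ (hαα i k h).1]
      exact (hαα i k h).2
    · simp
  have hFfin : ∀ i, (F i).Finite := fun i =>
    Set.Finite.of_finite_image ((P i).finite_toSet.subset (hFP i)) (hFinj i)
  have hFc : ∀ i, (F i).ncard ≤ (9 * m + 3) * m := by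
    intro i
    rw [← (hFinj i).ncard_image]
    refine (Set.ncard_le_ncard (hFP i) (P i).finite_toSet).trans ?_
    rw [Set.ncard_coe_finset]
    exact hPc i
  let lab : Fin (2 * Fintype.card (PatKey m) + 1) → Fin (9 * m + 3) → ℕ := fun j i =>
    {v | v ∈ F i ∧ v < u i j}.ncard
  have hlabc : ∀ j i, lab j i < (9 * m + 3) * m + 1 := by
    intro j i
    have : {v | v ∈ F i ∧ v < u i j}.ncard ≤ (F i).ncard :=
      Set.ncard_le_ncard (fun v hv => hv.1) (hFfin i)
    exact Nat.lt_succ_of_le (this.trans (hFc i))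
  have huF : ∀ i j, u i j ∉ F i := by
    rintro i j ⟨-, k, hk, h⟩
    rw [hgu] at h
    exact h3a _ i j k (hpa i j) (hpb i j) hk h
  have hlabeq : ∀ i j j', lab j i = lab j' i → ∀ v ∈ F i, u i j ≤ v → v ≤ u i j' → False := by
    intro i j j' h v hv h1 h2
    have h2' : v < u i j' := lt_of_le_of_ne h2 fun e => huF i j' (e ▸ hv)
    have : {v | v ∈ F i ∧ v < u i j}.ncard < {v | v ∈ F i ∧ v < u i j'}.ncard := by
      refine Set.ncard_lt_ncard ⟨?_, ?_⟩ ((hFfin i).subset fun v hv => hv.1)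
      · rintro w ⟨hw, hw'⟩
        exact ⟨hw, by linarith⟩
      · intro hsub
        exact absurd (hsub ⟨hv, h2'⟩).2 (not_lt.2 h1)
    exact this.ne h
  let key : Fin (2 * Fintype.card (PatKey m) + 1) → PatKey m := fun j =>
    (fun i k => decide (t i j < t k j), fun i => ⟨lab j i, hlabc j i⟩)
  obtain ⟨y, hy⟩ := Fintype.exists_lt_card_fiber_of_mul_lt_card (n := 2) key (by
    rw [Fintype.card_fin]
    omega)
  rw [Finset.two_lt_card] at hy
  obtain ⟨j0, hj0, j1, hj1, j2, hj2, n01, n02, n12⟩ := hy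
  simp only [Finset.mem_filter, Finset.mem_univ, true_and] at hj0 hj1 hj2
  let J : Fin 3 → Fin (2 * Fintype.card (PatKey m) + 1) := ![j0, j1, j2]
  have hJ : ∀ c, key (J c) = y := by
    intro c
    fin_cases c
    · exact hj0
    · exact hj1
    · exact hj2
  have hJinj : ∀ c d, c ≠ d → J c ≠ J d := by
    intro c d hcd
    fin_cases c <;> fin_cases d <;>
    first
    | exact absurd rfl hcd
    | exact n01
    | exact n02
    | exact n12
    | exact n01.symm
    | exact n02.symm
    | exact n12.symm
  have hordk : ∀ c d i k, t i (J c) < t k (J c) → t i (J d) < t k (J d) := by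
    intro c d i k h
    have e : key (J c) = key (J d) := (hJ c).trans (hJ d).symm
    have e2 := congrFun (congrFun (congrArg Prod.fst e) i) k
    simp only [key] at e2
    exact (decide_eq_decide.1 e2).1 h
  have hlabk : ∀ c d i, lab (J c) i = lab (J d) i := by
    intro c d i
    have e : key (J c) = key (J d) := (hJ c).trans (hJ d).symm
    have e2 := congrFun (congrArg Prod.snd e) i
    simp only [key, Fin.mk.injEq] at e2
    exact e2
  have htinj : ∀ i k j, t i j = t k j → i = k := by
    intro i k j h
    by_contra hne
    have e : p i j = p k j := by rw [← hft, ← hft, h]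
    exact h3a _ i j k (hpa i j) (hpb i j) (fun h => hne h.symm) (e ▸ hpa k j)
  let σ := Tuple.sort fun i => t i (J 0)
  have hσ : ∀ i k, i < k → t (σ i) (J 0) < t (σ k) (J 0) := by
    intro i k hik
    have := Tuple.monotone_sort (fun i => t i (J 0)) hik.le
    simp only [Function.comp_apply] at this
    refine lt_of_le_of_ne this fun h => ?_
    exact hik.ne (σ.injective (htinj _ _ _ h))
  refine no_triple m (fun i => α (σ i)) (fun c => β (J c)) (fun i => g (σ i)) (fun i => hg _)
    (fun c => f (J c)) (fun c => hf _) (fun i c => p (σ i) (J c)) (fun i c => hp _ _) ?_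
    (fun c d hcd => hββ _ _ (hJinj c d hcd)) (fun i c => u (σ i) (J c)) (fun i c => hu _ _)
    (fun i c => hgu _ _) (fun i c => t (σ i) (J c)) (fun i c => ht _ _) (fun i c => hft _ _) ?_ ?_
  · intro i c d hdc
    exact h3b _ (σ i) (J c) (J d) (hpa _ _) (hpb _ _) (hJinj d c hdc)
  · intro i k hki c d v hv h1 h2 hmem
    exact hlabeq (σ i) (J c) (J d) (hlabk c d _) v
      ⟨hv, σ k, fun h => hki (σ.injective h), hmem⟩ h1 h2
  · intro i k hik c
    exact hordk 0 c _ _ (hσ i k hik)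

/-! ## Part 7: the arrangement graph has no `K₅` minor -/

section arrangement

variable {n : ℕ} (γ : Fin n → Set Plane) (f : Fin n → ℝ → Plane)

/-- Incidence of intersection points and curves. -/
def vinc (i : Fin n) (v : interPoints γ) : Prop := v.1 ∈ γ i

/-- The union of the vertices of `S` and the edges with both ends in `S`. -/
def drawn (τ : Fin n → interPoints γ → ℝ) (S : Finset (interPoints γ)) : Set Plane :=
  {x | (∃ v ∈ S, x = v.1) ∨ ∃ i, ∃ q ∈ S, ∃ p ∈ S, Rec.Pred (vinc γ) τ i q p ∧
    x ∈ f i '' Set.Icc (τ i q) (τ i p)}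

variable {γ f}

theorem drawn_cases (hf : ∀ i, Param (γ i) (f i)) {τ : Fin n → interPoints γ → ℝ}
    (hτ : ∀ i v, vinc γ i v → τ i v ∈ Set.Ico (0:ℝ) 1 ∧ f i (τ i v) = v.1)
    {S : Finset (interPoints γ)} {x : Plane} (hx : x ∈ drawn γ f τ S) :
    (∃ v ∈ S, x = v.1) ∨ (x ∉ interPoints γ ∧ ∃ i, ∃ q ∈ S, ∃ p ∈ S, Rec.Pred (vinc γ) τ i q p ∧
      ∃ y, τ i q < y ∧ y < τ i p ∧ f i y = x) := by
  rcases hx with h | ⟨i, q, hq, p, hp, hpred, y, hy, rfl⟩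
  · exact Or.inl h
  rcases eq_or_lt_of_le hy.1 with h1 | h1
  · exact Or.inl ⟨q, hq, by rw [← h1, (hτ i q hpred.1).2]⟩
  rcases eq_or_lt_of_le hy.2 with h2 | h2
  · exact Or.inl ⟨p, hp, by rw [h2, (hτ i p hpred.2.1).2]⟩
  refine Or.inr ⟨fun hin => ?_, i, q, hq, p, hp, hpred, y, h1, h2, rfl⟩
  have hinc : vinc γ i ⟨f i y, hin⟩ := (hf i).mem y
  obtain ⟨ha, hb⟩ := hτ i _ hinc
  have hy01 : y ∈ Set.Ico (0:ℝ) 1 :=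
    ⟨(hτ i q hpred.1).1.1.trans hy.1, hy.2.trans_lt (hτ i p hpred.2.1).1.2⟩
  have e : τ i ⟨f i y, hin⟩ = y := (hf i).inj (s := 0) (by simpa using ha) (by simpa using hy01) hb
  have := hpred.2.2.2 _ hinc (by rw [e]; exact h1)
  rw [e] at this
  linarith

theorem drawn_disjoint (hf : ∀ i, Param (γ i) (f i)) {τ : Fin n → interPoints γ → ℝ}
    (hτ : ∀ i v, vinc γ i v → τ i v ∈ Set.Ico (0:ℝ) 1 ∧ f i (τ i v) = v.1)
    {S S' : Finset (interPoints γ)} (hS : Disjoint S S') :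
    Disjoint (drawn γ f τ S) (drawn γ f τ S') := by
  refine Set.disjoint_left.2 fun x hx hx' => ?_
  rcases drawn_cases hf hτ hx with ⟨v, hv, rfl⟩ | ⟨hxn, i, q, hq, p, hp, hpred, y, h1, h2, hy⟩
  · rcases drawn_cases hf hτ hx' with ⟨v', hv', h⟩ | ⟨hxn', _⟩
    · rw [Subtype.ext h] at hv
      exact Finset.disjoint_left.1 hS hv hv'
    · exact hxn' v.2
  · rcases drawn_cases hf hτ hx' with ⟨v', hv', rfl⟩ | ⟨_, i', q', hq', p', hp', hpred', y', h1', h2', hy'⟩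
    · exact hxn v'.2
    have hii : i = i' := by
      by_contra hne
      exact hxn ⟨i, i', hne, hy ▸ (hf i).mem y, hy' ▸ (hf i').mem y'⟩
    subst hii
    have hy01 : y ∈ Set.Ico (0:ℝ) 1 :=
      ⟨(hτ i q hpred.1).1.1.trans h1.le, h2.trans (hτ i p hpred.2.1).1.2⟩
    have hy01' : y' ∈ Set.Ico (0:ℝ) 1 :=
      ⟨(hτ i q' hpred'.1).1.1.trans h1'.le, h2'.trans (hτ i p' hpred'.2.1).1.2⟩
    have e : y = y' := (hf i).inj (s := 0) (by simpa using hy01) (by simpa using hy01')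
      (hy.trans hy'.symm)
    subst e
    have k1 := hpred.2.2.2 p' hpred'.2.1 (by linarith)
    have k2 := hpred'.2.2.2 p hpred.2.1 (by linarith)
    have k3 : τ i p = τ i p' := le_antisymm k1 k2
    have k4 : p = p' := by
      apply Subtype.ext
      rw [← (hτ i p hpred.2.1).2, ← (hτ i p' hpred'.2.1).2, k3]
    exact Finset.disjoint_left.1 hS hp (k4 ▸ hp')

theorem drawn_joined (hf : ∀ i, Param (γ i) (f i)) {τ : Fin n → interPoints γ → ℝ}
    (hτ : ∀ i v, vinc γ i v → τ i v ∈ Set.Ico (0:ℝ) 1 ∧ f i (τ i v) = v.1)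
    {S : Finset (interPoints γ)} (hS : Sep.Conn (Rec.adj (vinc γ) τ) S) {v w : interPoints γ}
    (hv : v ∈ S) (hw : w ∈ S) : JoinedIn (drawn γ f τ S) v.1 w.1 := by
  classical
  have harc : ∀ i, ∀ q ∈ S, ∀ p ∈ S, Rec.Pred (vinc γ) τ i q p →
      JoinedIn (drawn γ f τ S) q.1 p.1 := by
    intro i q hq p hp hpred
    have := (hf i).joined_image (convex_Icc (τ i q) (τ i p))
      (Set.left_mem_Icc.2 hpred.2.2.1.le) (Set.right_mem_Icc.2 hpred.2.2.1.le)
    rw [(hτ i q hpred.1).2, (hτ i p hpred.2.1).2] at this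
    exact this.mono fun x hx => Or.inr ⟨i, q, hq, p, hp, hpred, hx⟩
  have hsub : S ⊆ S.filter fun w => JoinedIn (drawn γ f τ S) v.1 w.1 := by
    refine hS.sub_of_closed ?_ v hv ?_
    · intro a ha haS b hb hab
      simp only [Finset.mem_filter] at ha ⊢
      refine ⟨hb, ha.2.trans ?_⟩
      obtain ⟨i, h | h⟩ := hab
      · exact harc i a haS b hb h
      · exact (harc i b hb a haS h).symm
    · simp only [Finset.mem_filter]
      exact ⟨hv, JoinedIn.refl (Or.inl ⟨v, hv, rfl⟩)⟩
  exact (Finset.mem_filter.1 (hsub hw)).2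

theorem no_K5_minor (hf : ∀ i, Param (γ i) (f i)) {τ : Fin n → interPoints γ → ℝ}
    (hτ : ∀ i v, vinc γ i v → τ i v ∈ Set.Ico (0:ℝ) 1 ∧ f i (τ i v) = v.1)
    (W : Finset (interPoints γ)) : ¬ Sep.K5Minor (Rec.adj (vinc γ) τ) W := by
  classical
  rintro ⟨B, hB, hBB⟩
  choose b hb using fun l => (hB l).1.1
  refine K5_plane (fun l => (b l).1) (fun k l => drawn γ f τ (B k ∪ B l)) ?_ ?_
  · intro k l hkl
    obtain ⟨-, v, hv, w, hw, hvw⟩ := hBB k l hkl.ne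
    have := Sep.conn_union (adj := Rec.adj (vinc γ) τ) Rec.adj_symm (hB k).1 (hB l).1 v w hv hw
      (Or.inl hvw)
    refine drawn_joined hf hτ ?_ (Finset.mem_union_left _ (hb k)) (Finset.mem_union_right _ (hb l))
    convert this
  · intro i j k l _ _ h1 h2 h3 h4
    refine drawn_disjoint hf hτ ?_
    rw [Finset.disjoint_union_left, Finset.disjoint_union_right, Finset.disjoint_union_right]
    exact ⟨⟨(hBB _ _ h1).1, (hBB _ _ h2).1⟩, (hBB _ _ h3).1, (hBB _ _ h4).1⟩

end arrangement

/-! ## Part 8: assembly -/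

namespace Final
open Classical Finset

theorem touch_bound {n : ℕ} (m : ℕ) {γ : Fin n → Set Plane} (hJ : ∀ i, IsJordanCurve (γ i))
    (hG : GenPos γ) (hM : MIntersecting m γ) (M : Finset (Fin n)) :
    (((M ×ˢ M).filter fun p => p.1 ≠ p.2 ∧ Touches (γ p.1) (γ p.2)).card : ℝ) ≤
      (((9 * m + 3 : ℕ) : ℝ) + ((2 * Fintype.card (PatKey m) + 1 : ℕ) : ℝ)) *
        (M.card : ℝ) ^ (2 - 1 / ((9 * m + 3 : ℕ) : ℝ)) := by
  have key := KST.kst (fun i j => i ≠ j ∧ Touches (γ i) (γ j)) (9 * m + 3)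
    (2 * Fintype.card (PatKey m) + 1) (by omega) ?_ M
  · convert key using 3
    ext p
    simp only [mem_filter]
  intro a b ha hb hR
  refine no_big_pattern m (α := fun i => γ (a i)) (β := fun j => γ (b j)) (fun i => hJ _)
    (fun j => hJ _) ?_ ?_ (fun i j => (hR i j).2) ?_ ?_
  · intro i k hik
    exact ⟨hG.1 _ _ (ha.ne hik), hM _ _ (ha.ne hik)⟩
  · intro i k hik
    exact ⟨hG.1 _ _ (hb.ne hik), hM _ _ (hb.ne hik)⟩
  · intro x i j k h1 h2 hki h3
    rcases hG.2 x _ _ _ h1 h2 h3 with h | h | h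
    · exact (hR i j).1 h
    · exact hki (ha h).symm
    · exact (hR k j).1 h.symm
  · intro x i j k h1 h2 hki h3
    rcases hG.2 x _ _ _ h1 h2 h3 with h | h | h
    · exact (hR i j).1 h
    · exact (hR i k).1 h
    · exact hki (hb h).symm

theorem interPoints_finite {n : ℕ} {γ : Fin n → Set Plane} (hG : GenPos γ) :
    (interPoints γ).Finite := by
  have h : interPoints γ ⊆ ⋃ i : Fin n, ⋃ j : Fin n, {x | i ≠ j ∧ x ∈ γ i ∧ x ∈ γ j} := by
    rintro x ⟨i, j, h⟩
    exact Set.mem_iUnion.2 ⟨i, Set.mem_iUnion.2 ⟨j, h⟩⟩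
  refine (Set.finite_iUnion fun i => Set.finite_iUnion fun j => ?_).subset h
  by_cases hij : i = j
  · simp [hij]
  · exact (hG.1 i j hij).subset fun x hx => hx.2

theorem main_bound (m : ℕ) (hm : 1 ≤ m) : ∃ K : ℝ, 0 < K ∧
    ∀ (n : ℕ) (γ : Fin n → Set Plane), (∀ i, IsJordanCurve (γ i)) → GenPos γ →
      MIntersecting m γ →
      (touchingPairs γ : ℝ) ≤ K * ((n : ℝ) ^ ((1:ℝ) / (9 * m + 46)) *
        ((interPoints γ).ncard : ℝ) ^ (1 - (1:ℝ) / (9 * m + 46))) := by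
  have hm0 : (0:ℝ) ≤ m := Nat.cast_nonneg m
  obtain ⟨K, hK, hrec⟩ := Rec.recursion ((1:ℝ) / (9 * m + 46)) (1 / ((9 * m + 3 : ℕ) : ℝ))
    (((9 * m + 3 : ℕ) : ℝ) + ((2 * Fintype.card (PatKey m) + 1 : ℕ) : ℝ)) (by positivity)
    (by
      push_cast
      exact one_div_lt_one_div_of_lt (by positivity) (by linarith))
    (by
      rw [div_le_one (by positivity)]
      push_cast
      linarith) (by positivity)
  refine ⟨K, hK, fun n γ hJ hG hM => ?_⟩
  have hfin := interPoints_finite hG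
  have : Fintype (interPoints γ) := hfin.fintype
  choose f hf using fun i => exists_param (hJ i)
  have hex : ∀ i (v : interPoints γ), ∃ t : ℝ, vinc γ i v → t ∈ Set.Ico (0:ℝ) 1 ∧ f i t = v.1 := by
    intro i v
    by_cases h : vinc γ i v
    · obtain ⟨t, ht, e⟩ := (hf i).surj 0 h
      exact ⟨t, fun _ => ⟨by simpa using ht, e⟩⟩
    · exact ⟨0, fun h' => absurd h' h⟩
  choose τ hτ using hex
  set touch : Finset (interPoints γ) :=
    univ.filter fun v => ∃ i j, i < j ∧ γ i ∩ γ j = {v.1} with htouch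
  have hpair : ∀ (p : Plane) (i j k l : Fin n), i < j → k < l → p ∈ γ i → p ∈ γ j → p ∈ γ k →
      p ∈ γ l → i = k ∧ j = l := by
    intro p i j k l hij hkl h1 h2 h3 h4
    have e1 := hG.2 p i j k h1 h2 h3
    have e2 := hG.2 p i j l h1 h2 h4
    omega
  have hT : touchingPairs γ ≤ touch.card := by
    have hex2 : ∀ p : Fin n × Fin n, ∃ v : Option (interPoints γ),
        (p.1 < p.2 ∧ Touches (γ p.1) (γ p.2)) → ∃ w, v = some w ∧ γ p.1 ∩ γ p.2 = {w.1} := by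
      intro p
      by_cases h : p.1 < p.2 ∧ Touches (γ p.1) (γ p.2)
      · obtain ⟨h1, x, hx⟩ := h
        have hxm : x ∈ γ p.1 ∩ γ p.2 := by rw [hx]; rfl
        exact ⟨some ⟨x, p.1, p.2, h1.ne, hxm.1, hxm.2⟩, fun _ => ⟨_, rfl, hx⟩⟩
      · exact ⟨none, fun h' => absurd h' h⟩
    choose F hF using hex2
    unfold touchingPairs
    rw [Set.ncard_eq_toFinset_card', 
      ← card_map (s := touch) (Function.Embedding.some : interPoints γ ↪ Option (interPoints γ))]
    refine card_le_card_of_injOn F ?_ ?_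
    · intro p hp
      have hp' : p.1 < p.2 ∧ Touches (γ p.1) (γ p.2) := by simpa using hp
      obtain ⟨w, hw, e⟩ := hF p hp'
      rw [hw]
      simp only [coe_map, Function.Embedding.some_apply, Set.mem_image]
      refine ⟨w, ?_, rfl⟩
      rw [mem_coe, htouch, mem_filter]
      exact ⟨mem_univ _, _, _, hp'.1, e⟩
    · intro p hp q hq hpq
      have hp' : p.1 < p.2 ∧ Touches (γ p.1) (γ p.2) := by simpa using hp
      have hq' : q.1 < q.2 ∧ Touches (γ q.1) (γ q.2) := by simpa using hq
      obtain ⟨w, hw, e⟩ := hF p hp'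
      obtain ⟨w', hw', e'⟩ := hF q hq'
      rw [hw, hw'] at hpq
      have hww : w = w' := Option.some.inj hpq
      subst hww
      have a1 : w.1 ∈ γ p.1 ∩ γ p.2 := by rw [e]; rfl
      have a2 : w.1 ∈ γ q.1 ∩ γ q.2 := by rw [e']; rfl
      obtain ⟨b1, b2⟩ := hpair _ _ _ _ _ hp'.1 hq'.1 a1.1 a1.2 a2.1 a2.2
      exact Prod.ext b1 b2
  have hmain := hrec (interPoints γ) n (vinc γ) τ touch ?_ ?_ ?_ ?_ ?_
  · have hc : (interPoints γ).ncard = Fintype.card (interPoints γ) := by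
      rw [Set.ncard_eq_toFinset_card', Set.toFinset_card]
    rw [hc]
    exact (by exact_mod_cast hT : (touchingPairs γ : ℝ) ≤ touch.card).trans hmain
  · intro i p q hp hq h
    apply Subtype.ext
    rw [← (hτ i p hp).2, ← (hτ i q hq).2, h]
  · intro v
    by_contra hc
    push Not at hc
    obtain ⟨i, hi, j, hj, k, hk, h1, h2, h3⟩ := two_lt_card.1 hc
    simp only [mem_filter, mem_univ, true_and] at hi hj hk
    rcases hG.2 v.1 i j k hi hj hk with h | h | h
    · exact h1 h
    · exact h2 h
    · exact h3 h
  · intro v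
    obtain ⟨i, -, -, hi, -⟩ := v.2
    exact ⟨i, hi⟩
  · exact no_K5_minor hf hτ _
  · intro W
    have hmi : ∀ v W, v ∈ (↑(@Inter.inter _ (@Finset.instInter _ (fun a b => propDecidable (a = b)))
        touch W) : Set (interPoints γ)) → v ∈ touch ∧ v ∈ W := by
      intro v W hv
      rw [mem_coe] at hv
      exact (@mem_inter _ (fun a b => propDecidable (a = b)) _ _ _).1 hv
    refine le_trans ?_ (touch_bound m hJ hG hM (Rec.Meets (vinc γ) W))
    have hex3 : ∀ v : interPoints γ, ∃ p : Fin n × Fin n, p.1 ≠ p.2 ∧ v.1 ∈ γ p.1 ∧ v.1 ∈ γ p.2 ∧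
        (v ∈ touch → γ p.1 ∩ γ p.2 = {v.1}) := by
      intro v
      by_cases h : v ∈ touch
      · have h' := h
        rw [htouch, mem_filter] at h'
        obtain ⟨-, i, j, hij, e⟩ := h'
        have a1 : v.1 ∈ γ i ∩ γ j := by rw [e]; rfl
        exact ⟨(i, j), hij.ne, a1.1, a1.2, fun _ => e⟩
      · obtain ⟨i, j, h1, h2, h3⟩ := v.2
        exact ⟨(i, j), h1, h2, h3, fun h' => absurd h' h⟩
    choose G hG1 hG2 hG3 hG4 using hex3
    norm_cast
    refine card_le_card_of_injOn G ?_ ?_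
    · intro v hv
      have hv' := hmi v W hv
      rw [mem_coe, mem_filter, mem_product, Rec.Meets, mem_filter, mem_filter]
      exact ⟨⟨⟨mem_univ _, v, hv'.2, hG2 v⟩, ⟨mem_univ _, v, hv'.2, hG3 v⟩⟩, hG1 v, v.1,
        hG4 v hv'.1⟩
    · intro v hv w hw h
      have hv' := hmi v W hv
      have hw' := hmi w W hw
      have e1 := hG4 v hv'.1
      have e2 := hG4 w hw'.1
      rw [h, e2] at e1
      exact Subtype.ext (Set.singleton_injective e1).symm

theorem final_arith (K a T n X : ℝ) (hK : 0 < K) (ha : 0 < a) (ha1 : a < 1) (hT : 0 ≤ T)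
    (hn : 0 < n) (hX : 0 ≤ X) (h : T ≤ K * (n ^ a * X ^ (1 - a))) :
    K ^ (-(1 / (1 - a))) * T * (T / n) ^ (a / (1 - a)) ≤ X := by
  have h1a : 0 < 1 - a := by linarith
  rcases eq_or_lt_of_le hT with h0 | hT
  · rw [← h0]
    simpa using hX
  have h1 : T ^ (1 / (1 - a)) ≤ (K * (n ^ a * X ^ (1 - a))) ^ (1 / (1 - a)) :=
    Real.rpow_le_rpow hT.le h (by positivity)
  rw [Real.mul_rpow hK.le (by positivity), Real.mul_rpow (by positivity) (by positivity),
    ← Real.rpow_mul hn.le, ← Real.rpow_mul hX, mul_one_div_cancel h1a.ne', Real.rpow_one,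
    mul_one_div] at h1
  have e : T ^ (1 / (1 - a)) = T * T ^ (a / (1 - a)) := by
    have : 1 / (1 - a) = 1 + a / (1 - a) := by field_simp; ring
    rw [this, Real.rpow_add hT, Real.rpow_one]
  have hKp : 0 < K ^ (1 / (1 - a)) := Real.rpow_pos_of_pos hK _
  have hnp : 0 < n ^ (a / (1 - a)) := Real.rpow_pos_of_pos hn _
  rw [Real.div_rpow hT.le hn.le, Real.rpow_neg hK.le]
  rw [e] at h1
  calc (K ^ (1 / (1 - a)))⁻¹ * T * (T ^ (a / (1 - a)) / n ^ (a / (1 - a)))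
      = (T * T ^ (a / (1 - a))) / (K ^ (1 / (1 - a)) * n ^ (a / (1 - a))) := by
        field_simp
    _ ≤ X := by
        rw [div_le_iff₀ (by positivity)]
        linarith

end Final

/-- Theorem (Main 2, for closed Jordan curves): an `m`-intersecting family of `n`
closed Jordan curves in general position with exactly `T ≥ n` touching pairs
determines at least `c · T · (T/n)^(1/(9m+45))` intersection points. -/
theorem crossing_lemma_m_intersecting (m : ℕ) (hm : 1 ≤ m) :
    ∃ c : ℝ, 0 < c ∧
      ∀ (n T : ℕ) (γ : Fin n → Set Plane),
        Function.Injective γ →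
        (∀ i, IsJordanCurve (γ i)) →
        GenPos γ →
        MIntersecting m γ →
        touchingPairs γ = T →
        n ≤ T →
        c * (T : ℝ) * ((T : ℝ) / (n : ℝ)) ^ ((1 : ℝ) / (9 * m + 45)) ≤
          ((interPoints γ).ncard : ℝ) := by
  obtain ⟨K, hK, hmain⟩ := Final.main_bound m hm
  have hm0 : (0:ℝ) ≤ m := Nat.cast_nonneg m
  refine ⟨K ^ (-(1 / (1 - (1:ℝ) / (9 * m + 46)))), Real.rpow_pos_of_pos hK _, ?_⟩
  intro n T γ _ hJ hG hM hT _
  have hb := hmain n γ hJ hG hM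
  rw [hT] at hb
  rcases Nat.eq_zero_or_pos n with h0 | hn
  · have h0' : (n : ℝ) = 0 := by exact_mod_cast h0
    rw [h0', div_zero, Real.zero_rpow (by positivity), mul_zero]
    positivity
  have e : (1:ℝ) / (9 * m + 45) = ((1:ℝ) / (9 * m + 46)) / (1 - (1:ℝ) / (9 * m + 46)) := by
    have h1 : (9 * m + 45 : ℝ) ≠ 0 := by positivity
    have h2 : (9 * m + 46 : ℝ) ≠ 0 := by positivity
    have h3 : 1 - (1:ℝ) / (9 * m + 46) = (9 * m + 45) / (9 * m + 46) := by
      field_simp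
      ring
    rw [h3]
    field_simp
  rw [e]
  exact Final.final_arith K _ T n _ hK (by positivity)
    (by rw [div_lt_one (by positivity)]; linarith) (Nat.cast_nonneg _) (by exact_mod_cast hn)
    (Nat.cast_nonneg _) hb
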